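/- arXiv:2010.03716 — 2 statements merged into one kernel-verified Lean document; each statement's English description precedes it below -/
import Mathlib

section
/- Let G be a simple connected positively curved (in the Lin–Lu–Yau sense) planar graph with minimum degree at least 3. Then G is finite; in particular, |V(G)| ≤ 17^544. -/
open Filter Set

variable {V : Type*}

-- The `α`-lazy random walk distribution at vertex `x`.
open Classical in
noncomputable def lazyWalk (G : SimpleGraph V) [G.LocallyFinite] (α : ℝ) (x : V) : V → ℝ :=
  fun v => if v = x then α else if G.Adj x v then (1 - α) / (G.degree x : ℝ) else 0

/-- `A` is a coupling between the finitely supported distributions `m₁` and `m₂`. -/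
def IsCoupling (m₁ m₂ : V → ℝ) (A : V → V → ℝ) : Prop :=
  (Function.support fun p : V × V => A p.1 p.2).Finite ∧
  (∀ x y, 0 ≤ A x y ∧ A x y ≤ 1) ∧
  (∀ x, ∑ᶠ y, A x y = m₁ x) ∧
  (∀ y, ∑ᶠ x, A x y = m₂ y)

/-- The transportation (Wasserstein) distance between two distributions on `V`,
with respect to the graph distance of `G`. -/
noncomputable def transportDist (G : SimpleGraph V) (m₁ m₂ : V → ℝ) : ℝ :=
  sInf {w : ℝ | ∃ A : V → V → ℝ, IsCoupling m₁ m₂ A ∧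
    w = ∑ᶠ p : V × V, A p.1 p.2 * (G.dist p.1 p.2 : ℝ)}

/-- The `α`-Ricci curvature `κ_α(x,y)`. -/
noncomputable def alphaRicci (G : SimpleGraph V) [G.LocallyFinite] (α : ℝ) (x y : V) : ℝ :=
  1 - transportDist G (lazyWalk G α x) (lazyWalk G α y) / (G.dist x y : ℝ)

/-- `κ` is the Lin–Lu–Yau Ricci curvature of the pair `(x,y)`:
the limit of `κ_α(x,y)/(1-α)` as `α → 1⁻`. -/
def HasLLYCurv (G : SimpleGraph V) [G.LocallyFinite] (x y : V) (κ : ℝ) : Prop :=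
  Tendsto (fun α : ℝ => alphaRicci G α x y / (1 - α)) (nhdsWithin 1 (Set.Iio 1)) (nhds κ)

/-- `G` is positively curved: every edge has positive Lin–Lu–Yau Ricci curvature. -/
def PositivelyCurved (G : SimpleGraph V) [G.LocallyFinite] : Prop :=
  ∀ ⦃x y : V⦄, G.Adj x y → ∃ κ : ℝ, 0 < κ ∧ HasLLYCurv G x y κ

/-- `G` is planar: it admits a topological embedding in the plane, i.e. an injective
placement of the vertices together with arcs for the edges, where arcs are injective
continuous curves joining the endpoints, not passing through any other vertex, and
two arcs of distinct edges meet only in common endpoints. -/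
def IsPlanar (G : SimpleGraph V) : Prop :=
  ∃ (f : V → ℝ × ℝ) (e : ∀ u v : V, G.Adj u v → Set.Icc (0:ℝ) 1 → ℝ × ℝ),
    Function.Injective f ∧
    (∀ u v (h : G.Adj u v), Continuous (e u v h)) ∧
    (∀ u v (h : G.Adj u v), Function.Injective (e u v h)) ∧
    (∀ u v (h : G.Adj u v),
      e u v h ⟨0, Set.left_mem_Icc.mpr zero_le_one⟩ = f u ∧
      e u v h ⟨1, Set.right_mem_Icc.mpr zero_le_one⟩ = f v) ∧
    (∀ u v (h : G.Adj u v) (w : V), w ≠ u → w ≠ v → f w ∉ Set.range (e u v h)) ∧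
    (∀ u v (h : G.Adj u v) (u' v' : V) (h' : G.Adj u' v'), ({u, v} : Set V) ≠ {u', v'} →
      Set.range (e u v h) ∩ Set.range (e u' v' h') ⊆ (f '' {u, v}) ∩ (f '' {u', v'}))

lemma lazyWalk_sum (G : SimpleGraph V) [G.LocallyFinite] (α : ℝ) (x : V) (hx : G.degree x ≠ 0)
    (U : Finset V) (hU1 : x ∈ U) (hU2 : G.neighborFinset x ⊆ U) (f : V → ℝ) :
    ∑ a ∈ U, lazyWalk G α x a * f a
      = α * f x + (1 - α) / (G.degree x : ℝ) * ∑ v ∈ G.neighborFinset x, f v := by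
  classical
  rw [← Finset.sum_erase_add _ _ hU1]
  have h1 : lazyWalk G α x x = α := by simp [lazyWalk]
  rw [h1, add_comm, Finset.mul_sum]
  congr 1
  have h2 : G.neighborFinset x ⊆ U.erase x := by
    intro v hv
    rw [Finset.mem_erase]
    refine ⟨?_, hU2 hv⟩
    rintro rfl
    simp at hv
  rw [← Finset.sum_subset h2]
  · apply Finset.sum_congr rfl
    intro v hv
    have hv' : G.Adj x v := by simpa using hv
    simp [lazyWalk, hv', hv'.ne']
  · intro v hv hv'
    have : ¬ G.Adj x v := by simpa using hv'
    simp [lazyWalk, this, (Finset.mem_erase.mp hv).1]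

lemma lazyWalk_zero (G : SimpleGraph V) [G.LocallyFinite] (α : ℝ) (x a : V)
    (U : Finset V) (hU1 : x ∈ U) (hU2 : G.neighborFinset x ⊆ U) (ha : a ∉ U) :
    lazyWalk G α x a = 0 := by
  classical
  have h1 : a ≠ x := by rintro rfl; exact ha hU1
  have h2 : ¬ G.Adj x a := fun h => ha (hU2 (by simpa using h))
  simp [lazyWalk, h1, h2]

lemma lazyWalk_bd (G : SimpleGraph V) [G.LocallyFinite] (α : ℝ) (h0 : 0 ≤ α) (h1 : α ≤ 1)
    (x a : V) : 0 ≤ lazyWalk G α x a ∧ lazyWalk G α x a ≤ 1 := by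
  classical
  unfold lazyWalk
  split_ifs with h h'
  · exact ⟨h0, h1⟩
  · have : 1 ≤ (G.degree x : ℝ) := by
      have : 0 < G.degree x := (G.degree_pos_iff_exists_adj x).2 ⟨a, h'⟩
      exact_mod_cast this
    refine ⟨div_nonneg (by linarith) (by linarith), ?_⟩
    rw [div_le_one (by linarith)]
    linarith
  · simp

lemma lip_dist (G : SimpleGraph V) (hconn : G.Connected) (f : V → ℤ)
    (hf : ∀ a b, G.Adj a b → f b - f a ≤ 1) (a b : V) : f b - f a ≤ G.dist a b := by
  obtain ⟨w, hw⟩ := hconn.exists_walk_length_eq_dist a b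
  rw [← hw]
  clear hw
  induction w with
  | nil => simp
  | cons h p ih =>
    have := hf _ _ h
    simp only [SimpleGraph.Walk.length_cons]
    push_cast
    linarith

lemma coupling_nonempty (G : SimpleGraph V) [G.LocallyFinite] (α : ℝ) (h0 : 0 ≤ α) (h1 : α ≤ 1)
    (x y : V) (hx : G.degree x ≠ 0) (hy : G.degree y ≠ 0) :
    ∃ A, IsCoupling (lazyWalk G α x) (lazyWalk G α y) A := by
  classical
  let U : Finset V := {x, y} ∪ (G.neighborFinset x ∪ G.neighborFinset y)
  have hx1 : x ∈ U := by simp [U]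
  have hy1 : y ∈ U := by simp [U]
  have hx2 : G.neighborFinset x ⊆ U := by intro v hv; simp only [U, Finset.mem_union]; tauto
  have hy2 : G.neighborFinset y ⊆ U := by intro v hv; simp only [U, Finset.mem_union]; tauto
  have sx : ∀ a, a ∉ U → lazyWalk G α x a = 0 := fun a ha => lazyWalk_zero G α x a U hx1 hx2 ha
  have sy : ∀ a, a ∉ U → lazyWalk G α y a = 0 := fun a ha => lazyWalk_zero G α y a U hy1 hy2 ha
  have tx : ∑ᶠ a, lazyWalk G α x a = 1 := by
    rw [finsum_eq_sum_of_support_subset (s := U)]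
    · have := lazyWalk_sum G α x hx U hx1 hx2 (fun _ => 1)
      simp at this
      rw [this]
      have : (G.degree x : ℝ) ≠ 0 := by exact_mod_cast hx
      field_simp
      ring
    · intro a ha
      by_contra h
      exact ha (sx a h)
  have ty : ∑ᶠ a, lazyWalk G α y a = 1 := by
    rw [finsum_eq_sum_of_support_subset (s := U)]
    · have := lazyWalk_sum G α y hy U hy1 hy2 (fun _ => 1)
      simp at this
      rw [this]
      have : (G.degree y : ℝ) ≠ 0 := by exact_mod_cast hy
      field_simp
      ring
    · intro a ha
      by_contra h
      exact ha (sy a h)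
  refine ⟨fun a b => lazyWalk G α x a * lazyWalk G α y b, ?_, ?_, ?_, ?_⟩
  · apply (U ×ˢ U).finite_toSet.subset
    rintro ⟨a, b⟩ hab
    simp only [Function.mem_support, ne_eq, mul_eq_zero, not_or] at hab
    simp only [Finset.coe_product, Set.mem_prod, Finset.mem_coe]
    exact ⟨by by_contra h; exact hab.1 (sx a h), by by_contra h; exact hab.2 (sy b h)⟩
  · intro a b
    have ha := lazyWalk_bd G α h0 h1 x a
    have hb := lazyWalk_bd G α h0 h1 y b
    exact ⟨mul_nonneg ha.1 hb.1, mul_le_one₀ ha.2 hb.1 hb.2⟩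
  · intro a
    rw [← mul_finsum', ty, mul_one]
    exact U.finite_toSet.subset (fun a ha => by by_contra h; exact ha (sy a h))
  · intro b
    rw [← finsum_mul', tx, one_mul]
    exact U.finite_toSet.subset (fun a ha => by by_contra h; exact ha (sx a h))

lemma coupling_cost (G : SimpleGraph V) [G.LocallyFinite] (hconn : G.Connected) (α : ℝ)
    (x y : V) (hx : G.degree x ≠ 0) (hy : G.degree y ≠ 0) (A : V → V → ℝ)
    (hA : IsCoupling (lazyWalk G α x) (lazyWalk G α y) A) (f : V → ℤ)
    (hf : ∀ a b, G.Adj a b → f b - f a ≤ 1) :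
    (α * f y + (1 - α) / (G.degree y : ℝ) * ∑ v ∈ G.neighborFinset y, (f v : ℝ)) -
    (α * f x + (1 - α) / (G.degree x : ℝ) * ∑ v ∈ G.neighborFinset x, (f v : ℝ)) ≤
     ∑ᶠ p : V × V, A p.1 p.2 * (G.dist p.1 p.2 : ℝ) := by
  classical
  obtain ⟨hfin, hbd, hm1, hm2⟩ := hA
  let T := hfin.toFinset
  let U : Finset V := T.image Prod.fst ∪ T.image Prod.snd ∪
    ({x, y} ∪ (G.neighborFinset x ∪ G.neighborFinset y))
  have hx1 : x ∈ U := by simp [U]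
  have hy1 : y ∈ U := by simp [U]
  have hx2 : G.neighborFinset x ⊆ U := by intro v hv; simp only [U, Finset.mem_union]; tauto
  have hy2 : G.neighborFinset y ⊆ U := by intro v hv; simp only [U, Finset.mem_union]; tauto
  have hT : ∀ a b, A a b ≠ 0 → a ∈ U ∧ b ∈ U := by
    intro a b hab
    have : (a, b) ∈ T := by simpa [T] using hab
    simp only [U, Finset.mem_union, Finset.mem_image]
    exact ⟨Or.inl (Or.inl ⟨_, this, rfl⟩), Or.inl (Or.inr ⟨_, this, rfl⟩)⟩
  have r1 : ∀ a, ∑ b ∈ U, A a b = lazyWalk G α x a := by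
    intro a
    rw [← hm1, finsum_eq_sum_of_support_subset (s := U)]
    intro b hb
    exact (hT a b hb).2
  have r2 : ∀ b, ∑ a ∈ U, A a b = lazyWalk G α y b := by
    intro b
    rw [← hm2, finsum_eq_sum_of_support_subset (s := U)]
    intro a ha
    exact (hT a b ha).1
  rw [← lazyWalk_sum G α x hx U hx1 hx2 (fun v => (f v : ℝ)),
    ← lazyWalk_sum G α y hy U hy1 hy2 (fun v => (f v : ℝ)),
    finsum_eq_sum_of_support_subset (s := U ×ˢ U)]
  · simp_rw [← r1, ← r2, Finset.sum_mul]
    rw [Finset.sum_comm, ← Finset.sum_product', ← Finset.sum_product', ← Finset.sum_sub_distrib]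
    apply Finset.sum_le_sum
    rintro ⟨a, b⟩ -
    have h1 : ((f b - f a : ℤ) : ℝ) ≤ ((G.dist a b : ℤ) : ℝ) := by
      exact_mod_cast lip_dist G hconn f hf a b
    push_cast at h1
    have h2 := (hbd a b).1
    simp only
    nlinarith
  · rintro ⟨a, b⟩ hab
    simp only [Function.mem_support, ne_eq, mul_eq_zero, not_or] at hab
    simpa using hT a b hab.1

lemma curv_ineq (G : SimpleGraph V) [G.LocallyFinite] (hconn : G.Connected)
    (hpos : PositivelyCurved G) {x y : V} (hxy : G.Adj x y) (f : V → ℤ)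
    (hf : ∀ a b, G.Adj a b → f b - f a ≤ 1) (hfy : f y = f x + 1) :
    (G.degree x : ℤ) * ∑ v ∈ G.neighborFinset y, (f v - f y) <
      (G.degree y : ℤ) * ∑ v ∈ G.neighborFinset x, (f v - f x) := by
  classical
  obtain ⟨κ, hκ, hlim⟩ := hpos hxy
  have hx : G.degree x ≠ 0 := ((G.degree_pos_iff_exists_adj x).2 ⟨y, hxy⟩).ne'
  have hy : G.degree y ≠ 0 := ((G.degree_pos_iff_exists_adj y).2 ⟨x, hxy.symm⟩).ne'
  have hx0 : (0 : ℝ) < G.degree x := by exact_mod_cast Nat.pos_of_ne_zero hx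
  have hy0 : (0 : ℝ) < G.degree y := by exact_mod_cast Nat.pos_of_ne_zero hy
  set sx : ℝ := ∑ v ∈ G.neighborFinset x, (f v : ℝ) with hsx
  set sy : ℝ := ∑ v ∈ G.neighborFinset y, (f v : ℝ) with hsy
  have key : κ ≤ 1 + sx / G.degree x - sy / G.degree y := by
    refine le_of_tendsto hlim ?_
    have : Ioo (0 : ℝ) 1 ∈ nhdsWithin (1 : ℝ) (Iio 1) := Ioo_mem_nhdsLT one_pos
    filter_upwards [this] with α hα
    have hα1 : 0 < 1 - α := by linarith [hα.2]
    rw [div_le_iff₀ hα1]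
    unfold alphaRicci
    rw [SimpleGraph.dist_eq_one_iff_adj.2 hxy]
    have hW : (α * f y + (1 - α) / (G.degree y : ℝ) * sy) -
      (α * f x + (1 - α) / (G.degree x : ℝ) * sx) ≤
        transportDist G (lazyWalk G α x) (lazyWalk G α y) := by
      unfold transportDist
      apply le_csInf
      · obtain ⟨A, hA⟩ := coupling_nonempty G α hα.1.le hα.2.le x y hx hy
        exact ⟨_, A, hA, rfl⟩
      · rintro w ⟨A, hA, rfl⟩
        exact coupling_cost G hconn α x y hx hy A hA f hf
    have hfy' : (f y : ℝ) = f x + 1 := by exact_mod_cast hfy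
    rw [hfy'] at hW
    have e1 : (1 - α) / (G.degree y : ℝ) * sy = (sy / G.degree y) * (1 - α) := by ring
    have e2 : (1 - α) / (G.degree x : ℝ) * sx = (sx / G.degree x) * (1 - α) := by ring
    rw [e1, e2] at hW
    push_cast
    rw [div_one]
    nlinarith
  have h3 : 0 < 1 + sx / G.degree x - sy / G.degree y := lt_of_lt_of_le hκ key
  have h4 : 0 < (1 + sx / G.degree x - sy / G.degree y) * (G.degree x * G.degree y) := by positivity
  have h5 : (1 + sx / G.degree x - sy / G.degree y) * (G.degree x * G.degree y)
    = G.degree x * G.degree y + sx * G.degree y - sy * G.degree x := by field_simp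
  rw [h5] at h4
  rw [Finset.sum_sub_distrib, Finset.sum_sub_distrib, Finset.sum_const, Finset.sum_const,
    SimpleGraph.card_neighborFinset_eq_degree, SimpleGraph.card_neighborFinset_eq_degree, hfy]
  have hsx' : sx = ((∑ v ∈ G.neighborFinset x, f v : ℤ) : ℝ) := by rw [hsx]; push_cast; rfl
  have hsy' : sy = ((∑ v ∈ G.neighborFinset y, f v : ℤ) : ℝ) := by rw [hsy]; push_cast; rfl
  rw [hsx', hsy'] at h4
  have h6 : (0 : ℤ) < G.degree x * G.degree y + (∑ v ∈ G.neighborFinset x, f v) * G.degree y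
     - (∑ v ∈ G.neighborFinset y, f v) * G.degree x := by exact_mod_cast h4
  simp only [nsmul_eq_mul]
  nlinarith

lemma exp_lift {A : Type} [TopologicalSpace A] [SimplyConnectedSpace A]
    [LocallyPathConnectedSpace A] (g : A → ℂ) (hg : Continuous g) (h0 : ∀ a, g a ≠ 0) :
    ∃ l : A → ℂ, Continuous l ∧ ∀ a, Complex.exp (l a) = g a := by
  have a0 : A := Classical.arbitrary A
  have h := Complex.isCoveringMapOn_exp.existsUnique_continuousMap_lifts (A := A)
    ⟨g, hg⟩ (a₀ := a0) (e₀ := Complex.log (g a0)) (by simp [Complex.exp_log (h0 a0)])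
    (fun a => h0 a)
  obtain ⟨F, ⟨h1, h2⟩, -⟩ := h
  exact ⟨F, F.continuous, fun a => congrFun h2 a⟩

lemma lift_diff (l l' : ℝ → ℂ) (hl : Continuous l) (hl' : Continuous l')
    (h : ∀ t, Complex.exp (l t) = Complex.exp (l' t)) : l 1 - l 0 = l' 1 - l' 0 := by
  have h2 : l = fun t => l' t + (l 0 - l' 0) := by
    refine Complex.isCoveringMap_exp.eq_of_comp_eq hl (hl'.add continuous_const) ?_ 0 (by ring)
    funext t
    apply Subtype.ext
    show Complex.exp (l t) = Complex.exp (l' t + (l 0 - l' 0))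
    rw [Complex.exp_add, Complex.exp_sub, h 0, div_self (Complex.exp_ne_zero _), mul_one, h t]
  have := congrFun h2 1
  rw [this]; ring

open Complex in
lemma exp_pi_shift (z w : ℂ) (h : exp z = w) : exp (z + Real.pi * I) = -w := by
  rw [Complex.exp_add, h, Complex.exp_pi_mul_I]; ring

open Complex in
lemma angle_int (g : ℝ → ℂ) (hg : Continuous g) (w p q : ℂ) (hw : ∀ t, g t ≠ w)
    (hp : exp p = g 0 - w) (hq : exp q = g 1 - w) :
    ∃ n : ℤ, ∀ l : ℝ → ℂ, Continuous l → (∀ t, exp (l t) = g t - w) →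
      l 1 - l 0 = q - p + n * (2 * Real.pi * I) := by
  obtain ⟨l, hl, hl'⟩ := exp_lift (fun t => g t - w) (hg.sub continuous_const)
    (fun t => sub_ne_zero.2 (hw t))
  obtain ⟨n1, h1⟩ := Complex.exp_eq_exp_iff_exists_int.1 ((hl' 1).trans hq.symm)
  obtain ⟨n0, h0⟩ := Complex.exp_eq_exp_iff_exists_int.1 ((hl' 0).trans hp.symm)
  refine ⟨n1 - n0, fun m hm hm' => ?_⟩
  rw [lift_diff m l hm hl (fun t => by rw [hm', hl']), h1, h0]
  push_cast; ring

open Complex in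
lemma square_rel (g d : ℝ → ℂ) (hg : Continuous g) (hd : Continuous d)
    (h : ∀ s t, g s ≠ d t) : ∃ l1 l2 l3 l4 : ℝ → ℂ,
      Continuous l1 ∧ (∀ t, exp (l1 t) = g t - d 0) ∧
      Continuous l2 ∧ (∀ t, exp (l2 t) = d t - g 1) ∧
      Continuous l3 ∧ (∀ t, exp (l3 t) = d t - g 0) ∧
      Continuous l4 ∧ (∀ t, exp (l4 t) = g t - d 1) ∧
      (l1 1 - l1 0) + (l2 1 - l2 0) = (l3 1 - l3 0) + (l4 1 - l4 0) := by
  obtain ⟨L, hL, hL'⟩ := exp_lift (fun p : ℝ × ℝ => g p.1 - d p.2)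
    ((hg.comp continuous_fst).sub (hd.comp continuous_snd)) (fun p => sub_ne_zero.2 (h _ _))
  refine ⟨fun t => L (t, 0), fun t => L (1, t) + Real.pi * I, fun t => L (0, t) + Real.pi * I,
    fun t => L (t, 1), by fun_prop, fun t => hL' _, by fun_prop, fun t => ?_, by fun_prop,
    fun t => ?_, by fun_prop, fun t => hL' _, by ring⟩
  · rw [exp_pi_shift _ _ (hL' _)]; ring
  · rw [exp_pi_shift _ _ (hL' _)]; ring

open Complex in
/-- The continuous form of nonplanarity of `K_{3,3}`. -/
lemma k33_paths (a b : Fin 3 → ℂ) (g : Fin 3 → Fin 3 → ℝ → ℂ)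
    (hg : ∀ i j, Continuous (g i j)) (h0 : ∀ i j, g i j 0 = a i) (h1 : ∀ i j, g i j 1 = b j)
    (hd : ∀ i k j l, i ≠ k → j ≠ l → ∀ s t, g i j s ≠ g k l t) : False := by
  have oth : ∀ i : Fin 3, ∃ k, k ≠ i := by decide
  have haa : ∀ i k, i ≠ k → a i ≠ a k := by
    intro i k hik
    rw [← h0 i 0, ← h0 k 1]
    exact hd _ _ _ _ hik (by decide) _ _
  have hbb : ∀ j l, j ≠ l → b j ≠ b l := by
    intro i k hik
    rw [← h1 0 i, ← h1 1 k]
    exact hd _ _ _ _ (by decide) hik _ _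
  have hab : ∀ i j, a i ≠ b j := by
    intro i j
    obtain ⟨k, hk⟩ := oth i
    obtain ⟨l, hl⟩ := oth j
    rw [← h0 i l, ← h1 k j]
    exact hd _ _ _ _ hk.symm hl _ _
  let P : Fin 3 → Fin 3 → ℂ := fun i j => log (b j - a i)
  have hP : ∀ i j, exp (P i j) = b j - a i := fun i j =>
    Complex.exp_log (sub_ne_zero.2 (hab i j).symm)
  have hP' : ∀ i j, exp (P i j + Real.pi * I) = a i - b j := fun i j => by
    rw [exp_pi_shift _ _ (hP i j)]; ring
  let Q : Fin 3 → Fin 3 → ℂ := fun i k =>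
    if i < k then log (a k - a i) else log (a i - a k) + Real.pi * I
  have hQ : ∀ i k, i ≠ k → exp (Q i k) = a k - a i := by
    intro i k hik
    simp only [Q]
    split_ifs
    · exact Complex.exp_log (sub_ne_zero.2 (haa i k hik).symm)
    · rw [exp_pi_shift _ _ (Complex.exp_log (sub_ne_zero.2 (haa i k hik)))]; ring
  let R : Fin 3 → Fin 3 → ℂ := fun i k =>
    if i < k then log (b k - b i) else log (b i - b k) + Real.pi * I
  have hR : ∀ i k, i ≠ k → exp (R i k) = b k - b i := by
    intro i k hik
    simp only [R]
    split_ifs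
    · exact Complex.exp_log (sub_ne_zero.2 (hbb i k hik).symm)
    · rw [exp_pi_shift _ _ (Complex.exp_log (sub_ne_zero.2 (hbb i k hik)))]; ring
  have hn : ∀ i j k, ∃ n : ℤ, k ≠ i → ∀ l : ℝ → ℂ, Continuous l →
      (∀ t, exp (l t) = g i j t - a k) → l 1 - l 0 = P k j - Q k i + n * (2 * Real.pi * I) := by
    intro i j k
    by_cases hk : k = i
    · exact ⟨0, fun h => absurd hk h⟩
    · obtain ⟨l, hl⟩ := oth j
      obtain ⟨n, hn⟩ := angle_int (g i j) (hg i j) (a k) (Q k i) (P k j)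
        (fun t => by rw [← h0 k l]; exact hd _ _ _ _ (Ne.symm hk) hl.symm _ _)
        (by rw [h0, hQ k i hk]) (by rw [h1, hP])
      exact ⟨n, fun _ => hn⟩
  have hm : ∀ i j l, ∃ n : ℤ, l ≠ j → ∀ f : ℝ → ℂ, Continuous f →
      (∀ t, exp (f t) = g i j t - b l) →
      f 1 - f 0 = R l j - (P i l + Real.pi * I) + n * (2 * Real.pi * I) := by
    intro i j l
    by_cases hl : l = j
    · exact ⟨0, fun h => absurd hl h⟩
    · obtain ⟨k, hk⟩ := oth i
      obtain ⟨n, hn⟩ := angle_int (g i j) (hg i j) (b l) (P i l + Real.pi * I) (R l j)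
        (fun t => by rw [← h1 k l]; exact hd _ _ _ _ hk.symm (Ne.symm hl) _ _)
        (by rw [h0, hP']) (by rw [h1, hR _ _ hl])
      exact ⟨n, fun _ => hn⟩
  choose n hn using hn
  choose m hm using hm
  have main : ∀ i k j l, i < k → j ≠ l →
      2 * (n i j k + m k l j - n k l i - m i j l) = 1 + (if j < l then (1:ℤ) else -1) := by
    intro i k j l hik hjl
    obtain ⟨l1, l2, l3, l4, c1, e1, c2, e2, c3, e3, c4, e4, e⟩ :=
      square_rel (g i j) (g k l) (hg _ _) (hg _ _) (hd _ _ _ _ hik.ne hjl)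
    rw [hn i j k hik.ne' l1 c1 (by simpa [h0] using e1),
      hm k l j hjl l2 c2 (by simpa [h1] using e2),
      hn k l i hik.ne l3 c3 (by simpa [h0] using e3),
      hm i j l hjl.symm l4 c4 (by simpa [h1] using e4)] at e
    have q1 : Q k i = Q i k + Real.pi * I := by
      simp only [Q, hik, if_true, not_lt.2 hik.le, if_false]
    have q2 : R l j = R j l + (if j < l then (1:ℤ) else -1) * (Real.pi * I) := by
      rcases lt_or_gt_of_ne hjl with h | h
      · simp only [R, h, if_true, not_lt.2 h.le, if_false]; push_cast; ring
      · simp only [R, h, if_true, not_lt.2 h.le, if_false]; push_cast; ring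
    rw [q1, q2] at e
    have hpi : (Real.pi : ℂ) * I ≠ 0 := mul_ne_zero (by exact_mod_cast Real.pi_ne_zero) I_ne_zero
    have : ((2 * (n i j k + m k l j - n k l i - m i j l) : ℤ) : ℂ) * (Real.pi * I) =
        ((1 + (if j < l then (1:ℤ) else -1) : ℤ) : ℂ) * (Real.pi * I) := by
      push_cast
      push_cast at e
      linear_combination e
    exact_mod_cast mul_right_cancel₀ hpi this
  have E := fun j l h => main 0 1 j l (by decide) h
  have E' := fun j l h => main 0 2 j l (by decide) h
  have E'' := fun j l h => main 1 2 j l (by decide) h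
  have t1 := E 0 1 (by decide)
  have t2 := E 0 2 (by decide)
  have t3 := E 1 2 (by decide)
  have t4 := E 1 0 (by decide)
  have t5 := E 2 0 (by decide)
  have t6 := E 2 1 (by decide)
  have u1 := E' 0 1 (by decide)
  have u2 := E' 0 2 (by decide)
  have u3 := E' 1 2 (by decide)
  have u4 := E' 1 0 (by decide)
  have u5 := E' 2 0 (by decide)
  have u6 := E' 2 1 (by decide)
  have v1 := E'' 0 1 (by decide)
  have v2 := E'' 0 2 (by decide)
  have v3 := E'' 1 2 (by decide)
  have v4 := E'' 1 0 (by decide)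
  have v5 := E'' 2 0 (by decide)
  have v6 := E'' 2 1 (by decide)
  simp at t1 t2 t3 t4 t5 t6 u1 u2 u3 u4 u5 u6 v1 v2 v3 v4 v5 v6
  omega

/-- Connectedness of a vertex set inside the graph. -/
def GConn (G : SimpleGraph V) (P : Set V) : Prop :=
  ∃ c ∈ P, ∀ v ∈ P, Relation.ReflTransGen (fun a b => a ∈ P ∧ b ∈ P ∧ G.Adj a b) c v

lemma GConn.singleton (G : SimpleGraph V) (x : V) : GConn G {x} :=
  ⟨x, rfl, fun v hv => by rw [Set.mem_singleton_iff.1 hv]⟩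

lemma GConn.star (G : SimpleGraph V) (x : V) (S : Set V) (h : ∀ s ∈ S, G.Adj x s) :
    GConn G (insert x S) := by
  refine ⟨x, Set.mem_insert _ _, fun v hv => ?_⟩
  rcases hv with rfl | hv
  · exact Relation.ReflTransGen.refl
  · exact Relation.ReflTransGen.single ⟨Set.mem_insert _ _, Set.mem_insert_of_mem _ hv, h v hv⟩

/-- Nonplanarity of `K_{3,3}` minors of a special kind. -/
lemma k33_minor (G : SimpleGraph V) (hpl : IsPlanar G) (P : Fin 3 → Set V)
    (hP : ∀ i, GConn G (P i)) (hdis : ∀ i k, i ≠ k → Disjoint (P i) (P k))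
    (t : Fin 3 → V) (htinj : Function.Injective t) (htP : ∀ i j, t j ∉ P i)
    (hadj : ∀ i j, ∃ v ∈ P i, G.Adj v (t j)) : False := by
  obtain ⟨f, e, finj, econt, einj, eend, eav, ecr⟩ := hpl
  let U : Set V → Set (ℝ × ℝ) := fun P =>
    {z | (∃ p ∈ P, z = f p) ∨ ∃ u v, ∃ h : G.Adj u v, u ∈ P ∧ v ∈ P ∧ z ∈ Set.range (e u v h)}
  have hU : ∀ P Q : Set V, Disjoint P Q → ∀ z, z ∈ U P → z ∈ U Q → False := by
    intro P Q hPQ z hz hz'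
    rw [Set.disjoint_left] at hPQ
    rcases hz with ⟨p, hp, rfl⟩ | ⟨u, v, h, hu, hv, hz⟩
    · rcases hz' with ⟨q, hq, hpq⟩ | ⟨u, v, h, hu, hv, hz⟩
      · exact hPQ hp (finj hpq ▸ hq)
      · exact eav u v h p (fun h => hPQ hp (h ▸ hu)) (fun h => hPQ hp (h ▸ hv)) hz
    · rcases hz' with ⟨q, hq, rfl⟩ | ⟨u', v', h', hu', hv', hz'⟩
      · exact eav u v h q (fun h => hPQ (h ▸ hu) hq) (fun h => hPQ (h ▸ hv) hq) hz
      · have hne : ({u, v} : Set V) ≠ {u', v'} := by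
          intro hh
          have : u ∈ ({u', v'} : Set V) := hh ▸ Set.mem_insert _ _
          rcases this with h1 | h1
          · exact hPQ hu (h1 ▸ hu')
          · exact hPQ hu ((Set.mem_singleton_iff.1 h1) ▸ hv')
        obtain ⟨⟨p, hp, hpz⟩, ⟨q, hq, hqz⟩⟩ := ecr u v h u' v' h' hne ⟨hz, hz'⟩
        have hpP : p ∈ P := by
          rcases hp with rfl | hp
          · exact hu
          · rw [Set.mem_singleton_iff.1 hp]; exact hv
        have hqQ : q ∈ Q := by
          rcases hq with rfl | hp
          · exact hu'
          · rw [Set.mem_singleton_iff.1 hp]; exact hv'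
        exact hPQ hpP (finj (hpz.trans hqz.symm) ▸ hqQ)
  have hstep : ∀ (P : Set V) u v, u ∈ P → v ∈ P → G.Adj u v → JoinedIn (U P) (f u) (f v) := by
    intro P u v hu hv h
    refine ⟨⟨⟨e u v h, econt u v h⟩, (eend u v h).1, (eend u v h).2⟩, fun s => ?_⟩
    exact Or.inr ⟨u, v, h, hu, hv, ⟨s, rfl⟩⟩
  have hrt : ∀ (P : Set V) u v, u ∈ P →
      Relation.ReflTransGen (fun a b => a ∈ P ∧ b ∈ P ∧ G.Adj a b) u v →
      JoinedIn (U P) (f u) (f v) := by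
    intro P u v hu huv
    induction huv with
    | refl => exact JoinedIn.refl (Or.inl ⟨u, hu, rfl⟩)
    | tail _ h ih => exact ih.trans (hstep P _ _ h.1 h.2.1 h.2.2)
  choose c hc hreach using hP
  have hjoin : ∀ i j, JoinedIn (U (insert (t j) (P i))) (f (c i)) (f (t j)) := by
    intro i j
    obtain ⟨v, hv, hvt⟩ := hadj i j
    have h1 := hrt (insert (t j) (P i)) (c i) v (Set.mem_insert_of_mem _ (hc i)) (by
      refine Relation.ReflTransGen.mono ?_ _ _ (hreach i v hv)
      rintro a b ⟨ha, hb, hab⟩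
      exact ⟨Set.mem_insert_of_mem _ ha, Set.mem_insert_of_mem _ hb, hab⟩)
    exact h1.trans (hstep _ _ _ (Set.mem_insert_of_mem _ hv) (Set.mem_insert _ _) hvt)
  choose γ hγ using hjoin
  let φ := Complex.equivRealProdCLM.symm
  refine k33_paths (fun i => φ (f (c i))) (fun j => φ (f (t j)))
    (fun i j s => φ ((γ i j).extend s)) (fun i j => ?_) (fun i j => ?_) (fun i j => ?_) ?_
  · exact φ.continuous.comp (γ i j).continuous_extend
  · simp
  · simp
  · intro i k j l hik hjl s s' heq
    have heq' := φ.injective heq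
    have m1 : ∀ i j s, (γ i j).extend s ∈ U (insert (t j) (P i)) := by
      intro i j s
      have : (γ i j).extend s ∈ Set.range (γ i j).extend := ⟨s, rfl⟩
      rw [Path.extend_range] at this
      obtain ⟨r, hr⟩ := this
      rw [← hr]
      exact hγ i j r
    refine hU (insert (t j) (P i)) (insert (t l) (P k)) ?_ _ (m1 i j s) (heq' ▸ m1 k l s')
    rw [Set.disjoint_left]
    rintro z (rfl | hz) hz'
    · rcases hz' with h | h
      · exact hjl (htinj h)
      · exact htP _ _ h
    · rcases hz' with rfl | h
      · exact htP _ _ hz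
      · exact Set.disjoint_left.1 (hdis i k hik) hz h

lemma k33_card (G : SimpleGraph V) (hpl : IsPlanar G) {P1 P2 P3 : Set V}
    (h1 : GConn G P1) (h2 : GConn G P2) (h3 : GConn G P3)
    (d12 : Disjoint P1 P2) (d13 : Disjoint P1 P3) (d23 : Disjoint P2 P3) (T : Finset V)
    (hT : ∀ t ∈ T, t ∉ P1 ∧ t ∉ P2 ∧ t ∉ P3 ∧ (∃ v ∈ P1, G.Adj v t) ∧ (∃ v ∈ P2, G.Adj v t) ∧
      (∃ v ∈ P3, G.Adj v t)) : T.card ≤ 2 := by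
  by_contra hlt
  push Not at hlt
  obtain ⟨a, ha, b, hb, c, hc, hab, hac, hbc⟩ := Finset.two_lt_card.1 hlt
  have ka := hT a ha
  have kb := hT b hb
  have kc := hT c hc
  refine k33_minor G hpl ![P1, P2, P3] ?_ ?_ ![a, b, c] ?_ ?_ ?_
  · intro i; fin_cases i <;> assumption
  · intro i k; fin_cases i <;> fin_cases k <;> simp [d12, d13, d23, d12.symm, d13.symm, d23.symm]
  · intro i k; fin_cases i <;> fin_cases k <;> simp [hab, hac, hbc, hab.symm, hac.symm, hbc.symm]
  · intro i j; fin_cases i <;> fin_cases j <;> simp <;> tauto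
  · intro i j; fin_cases i <;> fin_cases j <;> simp <;> tauto

open Classical in
lemma star_ineq (G : SimpleGraph V) [G.LocallyFinite] (hconn : G.Connected)
    (hpos : PositivelyCurved G) {x u : V} (hxu : G.Adj x u) (B P : Finset V)
    (hB : ∀ b ∈ B, G.Adj u b ∧ b ≠ x)
    (hP : ∀ v, G.Adj x v → v ≠ u → (G.Adj u v ∨ ∃ b ∈ B, G.Adj b v) → v ∈ P) :
    G.degree x * B.card < G.degree u * (P.card + (B.filter (fun b => G.Adj x b)).card + 2) := by
  let A : Finset V := (G.neighborFinset x).filter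
    (fun v => v ≠ u ∧ ¬ G.Adj u v ∧ ∀ b ∈ B, ¬ G.Adj b v)
  have hA : ∀ v, v ∈ A ↔ G.Adj x v ∧ v ≠ u ∧ ¬ G.Adj u v ∧ ∀ b ∈ B, ¬ G.Adj b v := by
    intro v; simp [A]
  let U : Finset V := insert u B
  have hdis : ∀ v ∈ U, v ∉ A := by
    intro v hv hvA
    rw [hA] at hvA
    rcases Finset.mem_insert.1 hv with rfl | hv
    · exact hvA.2.1 rfl
    · exact hvA.2.2.1 (hB v hv).1
  have hnadj : ∀ v ∈ U, ∀ w ∈ A, ¬ G.Adj v w := by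
    intro v hv w hw hvw
    rw [hA] at hw
    rcases Finset.mem_insert.1 hv with rfl | hv
    · exact hw.2.2.1 hvw
    · exact hw.2.2.2 v hv hvw
  let f : V → ℤ := fun v => (if v ∈ U then 1 else 0) - (if v ∈ A then 1 else 0)
  have hfx : f x = 0 := by
    have h1 : x ∉ U := by
      intro h
      rcases Finset.mem_insert.1 h with h | h
      · exact hxu.ne h
      · exact (hB x h).2 rfl
    have h2 : x ∉ A := by rw [hA]; exact fun h => G.irrefl h.1
    simp [f, h1, h2]
  have hfu : f u = 1 := by
    have h1 : u ∈ U := Finset.mem_insert_self _ _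
    simp [f, h1, hdis u h1]
  have key := curv_ineq G hconn hpos hxu f (by
    intro a b hab
    by_cases ha : a ∈ U <;> by_cases hb : b ∈ U <;> by_cases ha' : a ∈ A <;> by_cases hb' : b ∈ A <;>
      simp [f, ha, hb, ha', hb']
    exact hnadj b hb a ha' hab.symm) (by rw [hfx, hfu]; rfl)
  have e1 : ∑ v ∈ G.neighborFinset u, (f v - f u) = (B.card : ℤ) - G.degree u := by
    rw [Finset.sum_sub_distrib, Finset.sum_const, hfu]
    simp only [f, Finset.sum_sub_distrib, Finset.sum_boole, G.card_neighborFinset_eq_degree]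
    have h1 : (G.neighborFinset u).filter (fun v => v ∈ U) = B := by
      ext v
      simp only [Finset.mem_filter, SimpleGraph.mem_neighborFinset, U, Finset.mem_insert]
      constructor
      · rintro ⟨h, rfl | h'⟩
        · exact (G.irrefl h).elim
        · exact h'
      · intro h
        exact ⟨(hB v h).1, Or.inr h⟩
    have h2 : (G.neighborFinset u).filter (fun v => v ∈ A) = ∅ := by
      ext v
      simp only [Finset.mem_filter, SimpleGraph.mem_neighborFinset, hA]
      simp; tauto
    rw [h1, h2]; simp
  have e2 : ∑ v ∈ G.neighborFinset x, (f v - f x) =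
      1 + ((B.filter (fun b => G.Adj x b)).card : ℤ) - A.card := by
    simp only [hfx, sub_zero]
    simp only [f, Finset.sum_sub_distrib, Finset.sum_boole]
    have h1 : (G.neighborFinset x).filter (fun v => v ∈ U) =
        insert u (B.filter (fun b => G.Adj x b)) := by
      ext v
      simp only [Finset.mem_filter, SimpleGraph.mem_neighborFinset, U, Finset.mem_insert]
      constructor
      · tauto
      · rintro (rfl | h)
        · exact ⟨hxu, Or.inl rfl⟩
        · tauto
    have h2 : (G.neighborFinset x).filter (fun v => v ∈ A) = A := by
      ext v
      simp only [Finset.mem_filter, SimpleGraph.mem_neighborFinset, hA]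
      tauto
    have h3 : u ∉ B.filter (fun b => G.Adj x b) := by
      intro h
      exact G.irrefl (hB u (Finset.mem_filter.1 h).1).1
    rw [h1, h2, Finset.card_insert_of_notMem h3]
    push_cast; ring
  rw [e1, e2] at key
  have e3 : G.degree x ≤ 1 + P.card + A.card := by
    rw [← G.card_neighborFinset_eq_degree]
    have : G.neighborFinset x ⊆ ({u} ∪ P) ∪ A := by
      intro v hv
      have hv' : G.Adj x v := by simpa using hv
      simp only [Finset.mem_union, Finset.mem_singleton, hA]
      by_cases h1 : v = u
      · tauto
      by_cases h2 : G.Adj u v ∨ ∃ b ∈ B, G.Adj b v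
      · exact Or.inl (Or.inr (hP v hv' h1 h2))
      · push Not at h2
        tauto
    refine (Finset.card_le_card this).trans ((Finset.card_union_le _ _).trans ?_)
    gcongr
    refine (Finset.card_union_le _ _).trans ?_
    simp
  have e4 : (G.degree x : ℤ) ≤ 1 + P.card + A.card := by exact_mod_cast e3
  have hk : (0 : ℤ) ≤ G.degree u := by positivity
  zify
  nlinarith

lemma dist_pred' (G : SimpleGraph V) (x v : V) (n : ℕ) (hr : G.Reachable x v)
    (h : G.dist x v = n + 1) : ∃ u, G.Adj u v ∧ G.Reachable x u ∧ G.dist x u = n := by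
  obtain ⟨w, hw⟩ := hr.symm.exists_walk_length_eq_dist
  rw [SimpleGraph.dist_comm, h] at hw
  cases w with
  | nil => simp at hw
  | @cons _ u _ hu p =>
    simp only [SimpleGraph.Walk.length_cons] at hw
    refine ⟨u, hu.symm, ⟨p.reverse⟩, ?_⟩
    have h1 : G.dist u x ≤ p.length := SimpleGraph.dist_le p
    have hux : G.Reachable u x := ⟨p⟩
    obtain ⟨q, hq⟩ := hux.exists_walk_length_eq_dist
    have h2 : G.dist v x ≤ (SimpleGraph.Walk.cons hu q).length := SimpleGraph.dist_le _
    simp only [SimpleGraph.Walk.length_cons] at h2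
    rw [SimpleGraph.dist_comm] at h1 h2
    rw [SimpleGraph.dist_comm] at hq
    omega

open Classical in
lemma level_lemma (G : SimpleGraph V) [G.LocallyFinite] (hpl : IsPlanar G) (x : V)
    (hx : 0 < G.degree x) :
    ∃ y, G.Adj x y ∧ ((G.neighborFinset x).filter (fun v => G.Adj y v)).card ≤ 4 := by
  obtain ⟨r, hr⟩ := (G.degree_pos_iff_exists_adj x).1 hx
  let H : SimpleGraph V :=
    { Adj := fun a b => G.Adj a b ∧ G.Adj x a ∧ G.Adj x b
      symm := ⟨fun a b h => ⟨h.1.symm, h.2.2, h.2.1⟩⟩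
      loopless := ⟨fun a h => G.irrefl h.1⟩ }
  have hHG : ∀ {a b}, H.Adj a b → G.Adj a b := fun h => h.1
  let R : Finset V := (G.neighborFinset x).filter (fun v => H.Reachable r v)
  have hrR : r ∈ R := by simp [R, hr]
  obtain ⟨y, hyR, hymax⟩ := Finset.exists_max_image R (fun v => H.dist r v) ⟨r, hrR⟩
  have hy : G.Adj x y ∧ H.Reachable r y := by simpa [R] using hyR
  refine ⟨y, hy.1, ?_⟩
  set D := H.dist r y with hD
  -- balls are connected
  let B : ℕ → Set V := fun j => {v | G.Adj x v ∧ H.Reachable r v ∧ H.dist r v ≤ j}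
  have hBconn : ∀ j, GConn G (B j) := by
    intro j
    refine ⟨r, ⟨hr, SimpleGraph.Reachable.refl _, by simp⟩, ?_⟩
    have : ∀ n v, v ∈ B j → H.dist r v = n →
        Relation.ReflTransGen (fun a b => a ∈ B j ∧ b ∈ B j ∧ G.Adj a b) r v := by
      intro n
      induction n with
      | zero =>
        intro v hv h0
        rw [hv.2.1.dist_eq_zero_iff] at h0
        rw [h0]
      | succ n ih =>
        intro v hv h0
        obtain ⟨u, hu, hru, hdu⟩ := dist_pred' H r v n hv.2.1 h0
        have huB : u ∈ B j := ⟨hu.2.1, hru, by have := hv.2.2; omega⟩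
        exact (ih u huB hdu).tail ⟨huB, hv, hHG hu⟩
    exact fun v hv => this _ v hv rfl
  have hxB : ∀ j, x ∉ B j := fun j h => G.irrefl h.1
  -- neighbours of y
  have hnb : ∀ v, G.Adj x v → G.Adj y v → H.Reachable r v ∧ H.dist r v ≤ D ∧ D ≤ H.dist r v + 1 := by
    intro v hxv hyv
    have hyv' : H.Adj y v := ⟨hyv, hy.1, hxv⟩
    have hrv : H.Reachable r v := hy.2.trans hyv'.reachable
    refine ⟨hrv, hymax v (by simp [R, hxv, hrv]), ?_⟩
    obtain ⟨q, hq⟩ := hrv.exists_walk_length_eq_dist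
    have := SimpleGraph.dist_le (q.concat hyv'.symm)
    rw [SimpleGraph.Walk.length_concat, hq] at this
    exact this
  have hlev : ∀ n T, (∀ v ∈ T, G.Adj x v ∧ G.Adj y v ∧ H.dist r v = n + 1) → n + 1 ≤ D →
      Finset.card T ≤ 2 := by
    intro n T hT hn
    have hyB : y ∉ B n := fun h => by have := h.2.2; omega
    refine k33_card G hpl (GConn.singleton G y) (GConn.singleton G x) (hBconn n) ?_ ?_ ?_ T ?_
    · rw [Set.disjoint_singleton]; exact hy.1.ne'
    · rw [Set.disjoint_singleton_left]; exact hyB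
    · rw [Set.disjoint_singleton_left]; exact hxB n
    · intro t ht
      obtain ⟨h1, h2, h3⟩ := hT t ht
      refine ⟨h2.ne', h1.ne', fun h => by have := h.2.2; omega, ⟨y, rfl, h2⟩, ⟨x, rfl, h1⟩, ?_⟩
      obtain ⟨u, hu, hru, hdu⟩ := dist_pred' H r t n (hnb t h1 h2).1 h3
      exact ⟨u, ⟨hu.2.1, hru, by omega⟩, hHG hu⟩
  set C := (G.neighborFinset x).filter (fun v => G.Adj y v) with hC
  have hCm : ∀ v, v ∈ C ↔ G.Adj x v ∧ G.Adj y v := by intro v; simp [hC]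
  have hzero : ∀ v ∈ C, H.dist r v = 0 → v = r := by
    intro v hv h
    rw [hCm] at hv
    exact ((hnb v hv.1 hv.2).1.dist_eq_zero_iff.1 h).symm
  have h1 : (C.filter (fun v => H.dist r v = D)).card ≤ 2 := by
    rcases Nat.eq_zero_or_pos D with h0 | h0
    · rw [Finset.card_eq_zero.2]; · omega
      rw [Finset.filter_eq_empty_iff]
      intro v hv hd
      have := hzero v hv (hd.trans h0)
      have h2 : r = y := hy.2.dist_eq_zero_iff.1 (hD ▸ h0)
      rw [hCm] at hv
      rw [this, ← h2] at hv
      exact G.irrefl hv.2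
    · obtain ⟨n, hn⟩ : ∃ n, D = n + 1 := ⟨D - 1, by omega⟩
      refine hlev n _ ?_ hn.ge
      intro v hv
      rw [Finset.mem_filter, hCm] at hv
      exact ⟨hv.1.1, hv.1.2, hv.2.trans hn⟩
  have h2 : (C.filter (fun v => H.dist r v + 1 = D)).card ≤ 2 := by
    rcases Nat.lt_or_ge 1 D with h0 | h0
    · obtain ⟨n, hn⟩ : ∃ n, D = n + 2 := ⟨D - 2, by omega⟩
      refine hlev n _ ?_ (by omega)
      intro v hv
      rw [Finset.mem_filter, hCm] at hv
      exact ⟨hv.1.1, hv.1.2, by omega⟩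
    · have : C.filter (fun v => H.dist r v + 1 = D) ⊆ {r} := by
        intro v hv
        rw [Finset.mem_filter] at hv
        rw [Finset.mem_singleton]
        exact hzero v hv.1 (by omega)
      have := Finset.card_le_card this
      rw [Finset.card_singleton] at this
      omega
  have : C ⊆ C.filter (fun v => H.dist r v = D) ∪ C.filter (fun v => H.dist r v + 1 = D) := by
    intro v hv
    have h := (hCm v).1 hv
    have := hnb v h.1 h.2
    rw [Finset.mem_union]
    rcases (by omega : H.dist r v = D ∨ H.dist r v + 1 = D) with h | h
    · exact Or.inl (Finset.mem_filter.2 ⟨hv, h⟩)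
    · exact Or.inr (Finset.mem_filter.2 ⟨hv, h⟩)
  have := (Finset.card_le_card this).trans (Finset.card_union_le _ _)
  omega

/-- `b` can be reached from `a` by a walk all of whose vertices after the first lie in `F`. -/
def FReach (G : SimpleGraph V) (F : Set V) (a b : V) : Prop :=
  Relation.ReflTransGen (fun p q => G.Adj p q ∧ q ∈ F) a b

lemma FReach.mem {G : SimpleGraph V} {F : Set V} {a b : V} (h : FReach G F a b) :
    b = a ∨ b ∈ F := by
  rcases Relation.ReflTransGen.cases_tail h with h | ⟨c, _, h⟩
  · exact Or.inl h
  · exact Or.inr h.2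

lemma FReach.gconn (G : SimpleGraph V) (F : Set V) (a : V) : GConn G {b | FReach G F a b} := by
  refine ⟨a, Relation.ReflTransGen.refl, fun v hv => ?_⟩
  have hv' : Relation.ReflTransGen (fun p q => G.Adj p q ∧ q ∈ F) a v := hv
  clear hv
  induction hv' with
  | refl => exact Relation.ReflTransGen.refl
  | tail h1 h2 ih => exact ih.tail ⟨h1, h1.tail h2, h2.1⟩

lemma FReach.symm {G : SimpleGraph V} {F : Set V} {a b : V} (ha : a ∈ F) (h : FReach G F a b) :
    FReach G F b a := by
  unfold FReach at h
  induction h with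
  | refl => exact Relation.ReflTransGen.refl
  | @tail c d h1 h2 ih =>
    have hc : c ∈ F := by
      rcases FReach.mem h1 with h | h
      · rw [h]; exact ha
      · exact h
    exact Relation.ReflTransGen.head ⟨h2.1.symm, hc⟩ ih

lemma FReach.front {G : SimpleGraph V} {F : Set V} {v b : V} (hv : v ∉ F) (hb : b ∈ F)
    (h : FReach G F v b) : ∃ w, G.Adj v w ∧ FReach G F b w := by
  rcases Relation.ReflTransGen.cases_head h with h | ⟨c, h1, h2⟩
  · exact absurd (h ▸ hb) hv
  · exact ⟨c, h1.1, FReach.symm h1.2 h2⟩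

open Classical in
lemma g3_count (S A : Finset V) (N : V → Finset V) (T : V → V → Prop)
    (hN : ∀ u ∈ S, (N u).card ≤ 2) (hNS : ∀ u ∈ S, N u ⊆ S)
    (hsym : ∀ u ∈ S, ∀ v ∈ S, v ∈ N u → u ∈ N v)
    (hT : ∀ a ∈ A, (S.filter (fun v => T v a)).card ≤ 2)
    (hTN : ∀ a ∈ A, ∀ u ∈ S, ∀ v ∈ S, u ≠ v → T u a → T v a → v ∈ N u) :
    ∑ u ∈ S, (A.filter (fun a => T u a ∨ ∃ v ∈ N u, T v a)).card ≤ 4 * A.card := by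
  have hsw := Finset.sum_card_bipartiteAbove_eq_sum_card_bipartiteBelow
    (s := S) (t := A) (fun u a => T u a ∨ ∃ v ∈ N u, T v a)
  unfold Finset.bipartiteAbove Finset.bipartiteBelow at hsw
  rw [hsw]
  refine (Finset.sum_le_card_nsmul _ _ 4 ?_).trans (by simp [mul_comm])
  intro a ha
  set Ta := S.filter (fun v => T v a) with hTa
  have hsub : S.filter (fun u => T u a ∨ ∃ v ∈ N u, T v a) ⊆
      Ta ∪ Ta.biUnion (fun v => N v \ Ta) := by
    intro u hu
    rw [Finset.mem_filter] at hu
    rw [Finset.mem_union, Finset.mem_biUnion]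
    by_cases h : u ∈ Ta
    · exact Or.inl h
    · right
      rcases hu.2 with h' | ⟨v, hv, hva⟩
      · exact absurd (Finset.mem_filter.2 ⟨hu.1, h'⟩) h
      · have hvS := hNS u hu.1 hv
        exact ⟨v, Finset.mem_filter.2 ⟨hvS, hva⟩, Finset.mem_sdiff.2 ⟨hsym u hu.1 v hvS hv, h⟩⟩
  refine (Finset.card_le_card hsub).trans ((Finset.card_union_le _ _).trans ?_)
  have hb := Finset.card_biUnion_le (s := Ta) (t := fun v => N v \ Ta)
  have h2 : Ta.card ≤ 2 := hT a ha
  rcases (by omega : Ta.card ≤ 1 ∨ Ta.card = 2) with h1 | h1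
  · have : ∑ v ∈ Ta, (N v \ Ta).card ≤ Ta.card • 2 := by
      apply Finset.sum_le_card_nsmul
      intro v hv
      exact (Finset.card_le_card Finset.sdiff_subset).trans (hN v (Finset.mem_filter.1 hv).1)
    simp only [smul_eq_mul] at this
    omega
  · have : ∑ v ∈ Ta, (N v \ Ta).card ≤ Ta.card • 1 := by
      apply Finset.sum_le_card_nsmul
      intro v hv
      obtain ⟨w, hw, hwv⟩ := Finset.exists_mem_ne (by omega : 1 < Ta.card) v
      have hv' := Finset.mem_filter.1 hv
      have hw' := Finset.mem_filter.1 hw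
      have hwN : w ∈ N v := hTN a ha v hv'.1 w hw'.1 hwv.symm hv'.2 hw'.2
      have : N v \ Ta ⊆ (N v).erase w := by
        intro z hz
        rw [Finset.mem_sdiff] at hz
        rw [Finset.mem_erase]
        exact ⟨fun h => hz.2 (h ▸ hw), hz.1⟩
      have h3 := Finset.card_le_card this
      rw [Finset.card_erase_of_mem hwN] at h3
      have := hN v hv'.1
      omega
    simp only [smul_eq_mul] at this
    omega

open Classical in
lemma sigma_count (S W : Finset V) (r : V → V → Prop) (σ : V → ℕ)
    (h1 : ∀ u ∈ S, (W.filter (fun z => r u z)).card ≤ 2)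
    (h2 : ∀ z ∈ W, (S.filter (fun u => r u z ∧ (W.filter (fun z => r u z)).card = 2)).card ≤ 2)
    (h3 : ∀ z ∈ W, 1 ≤ (S.filter (fun u => r u z)).card)
    (hσ0 : ∀ u ∈ S, (W.filter (fun z => r u z)).card ≠ 2 → σ u = 0)
    (hσ : ∀ u ∈ S, (W.filter (fun z => r u z)).card = 2 →
      2 * σ u ≤ ∑ z ∈ W.filter (fun z => r u z), ((S.filter (fun u => r u z)).card - 1)) :
    ∑ u ∈ S, σ u ≤ S.card := by
  set E : V → Finset V := fun u => W.filter (fun z => r u z) with hE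
  set N : V → ℕ := fun z => (S.filter (fun u => r u z)).card with hN
  set S2 := S.filter (fun u => (E u).card = 2) with hS2
  have hf : ∀ z, S.filter (fun u => r u z ∧ (E u).card = 2) = S2.filter (fun u => r u z) := by
    intro z; ext u; simp only [hS2, Finset.mem_filter]; tauto
  have a1 : ∑ u ∈ S, σ u = ∑ u ∈ S2, σ u := by
    rw [hS2, Finset.sum_filter]
    apply Finset.sum_congr rfl
    intro u hu
    split_ifs with h
    · rfl
    · exact hσ0 u hu h
  have a2 : 2 * ∑ u ∈ S2, σ u ≤ ∑ u ∈ S2, ∑ z ∈ E u, (N z - 1) := by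
    rw [Finset.mul_sum]
    apply Finset.sum_le_sum
    intro u hu
    have := Finset.mem_filter.1 hu
    exact hσ u this.1 this.2
  have a3 : ∑ u ∈ S2, ∑ z ∈ E u, (N z - 1) =
      ∑ z ∈ W, (S2.filter (fun u => r u z)).card * (N z - 1) := by
    simp only [hE, Finset.sum_filter]
    rw [Finset.sum_comm]
    apply Finset.sum_congr rfl
    intro z _
    rw [← Finset.sum_filter, Finset.sum_const, smul_eq_mul]
  have a4 : ∑ z ∈ W, (S2.filter (fun u => r u z)).card * (N z - 1) ≤ ∑ z ∈ W, 2 * (N z - 1) := by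
    apply Finset.sum_le_sum
    intro z hz
    have := h2 z hz
    rw [hf] at this
    gcongr
  have a5 : ∑ z ∈ W, (N z - 1) + W.card = ∑ z ∈ W, N z := by
    rw [Finset.card_eq_sum_ones, ← Finset.sum_add_distrib]
    apply Finset.sum_congr rfl
    intro z hz
    have := h3 z hz
    simp only [hN]
    omega
  have a6 : ∑ u ∈ S, (E u).card = ∑ z ∈ W, N z :=
    Finset.sum_card_bipartiteAbove_eq_sum_card_bipartiteBelow r
  have a7 : ∑ u ∈ S, (E u).card ≤ S.card + S2.card := by
    rw [hS2, Finset.card_filter, Finset.card_eq_sum_ones, ← Finset.sum_add_distrib]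
    apply Finset.sum_le_sum
    intro u hu
    have := h1 u hu
    split_ifs with h
    · omega
    · have : (E u).card ≤ 2 := this
      omega
  have a8 : 2 * S2.card ≤ 2 * W.card := by
    have b1 : ∑ u ∈ S2, (E u).card = 2 * S2.card := by
      rw [Finset.sum_congr rfl (g := fun _ => 2)]
      · simp [mul_comm]
      · intro u hu; exact (Finset.mem_filter.1 hu).2
    have b2 : ∑ u ∈ S2, (E u).card = ∑ z ∈ W, (S2.filter (fun u => r u z)).card :=
      Finset.sum_card_bipartiteAbove_eq_sum_card_bipartiteBelow r
    rw [← b1, b2]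
    refine (Finset.sum_le_card_nsmul _ _ 2 ?_).trans (by simp [mul_comm])
    intro z hz
    rw [← hf]
    exact h2 z hz
  rw [← Finset.mul_sum] at a4
  omega

/-- numeric part -/
lemma num_A (d k c s A : ℕ) (hd : 37 ≤ d) (hc : c ≤ 4) (hk : 3 ≤ k) (hkc : c + 1 ≤ k)
    (hsum : d = 1 + c + s + A) (h : d * (k - 1) < k * (c + s + c + 2)) (T : ℕ)
    (hT : T = if c ≤ 2 then 4 else 3) : 4 * A < T * s := by
  obtain ⟨k', rfl⟩ : ∃ k', k = k' + 1 := ⟨k - 1, by omega⟩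
  simp only [Nat.add_sub_cancel] at h
  by_contra hcon
  push Not at hcon
  have hA : c + 1 ≤ A := by
    by_contra hA
    have : T = 4 ∨ T = 3 := by split_ifs at hT <;> omega
    rcases this with rfl | rfl <;> omega
  obtain ⟨B, rfl⟩ : ∃ B, A = B + (c + 1) := ⟨A - (c + 1), by omega⟩
  have h5 : (k' + 1) * B < d := by
    subst hsum
    nlinarith
  interval_cases c
  all_goals simp at hT; subst hT
  · have : 3 * B ≤ (k' + 1) * B := Nat.mul_le_mul_right _ hk
    omega
  · have : 3 * B ≤ (k' + 1) * B := Nat.mul_le_mul_right _ hk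
    omega
  · have : 3 * B ≤ (k' + 1) * B := Nat.mul_le_mul_right _ hk
    omega
  · have : 4 * B ≤ (k' + 1) * B := Nat.mul_le_mul_right _ hkc
    omega
  · have : 5 * B ≤ (k' + 1) * B := Nat.mul_le_mul_right _ hkc
    omega

lemma num_final (d k c g s T : ℕ) (hd : 37 ≤ d) (hc : c ≤ 4) (hT : T = if c ≤ 2 then 4 else 3)
    (hgs : g + s ≤ T) (hk : 3 ≤ k)
    (h3 : k = 3 → d < 3 * (5 + c + g + s))
    (h4 : k = 4 → d * 2 < 4 * (9 + c + g + s))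
    (h5 : d * (k - 2) < k * (11 + c + s + 2 * g)) : False := by
  have hX : c + T ≤ 7 ∧ c + 2 * T ≤ 10 := by
    split_ifs at hT <;> omega
  rcases (by omega : k = 3 ∨ k = 4 ∨ 5 ≤ k) with h | h | h
  · have := h3 h; omega
  · have := h4 h; omega
  · obtain ⟨j, rfl⟩ : ∃ j, k = j + 2 := ⟨k - 2, by omega⟩
    simp only [Nat.add_sub_cancel] at h5
    have h6 : (j + 2) * (11 + c + s + 2 * g) ≤ (j + 2) * 21 := Nat.mul_le_mul_left _ (by omega)
    have h7 : 37 * j ≤ d * j := Nat.mul_le_mul_right _ hd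
    omega

set_option maxHeartbeats 4000000 in
open Classical in
theorem degree_le_36 (G : SimpleGraph V) [G.LocallyFinite]
    (hconn : G.Connected) (hpl : IsPlanar G)
    (hmin : ∀ u : V, 3 ≤ G.degree u) (hpos : PositivelyCurved G) (x : V) : G.degree x ≤ 36 := by
  by_contra hd
  have hd : 37 ≤ G.degree x := by omega
  obtain ⟨y, hxy, hc⟩ := level_lemma G hpl x (by omega)
  set C := (G.neighborFinset x).filter (fun v => G.Adj y v) with hC
  have hCm : ∀ v, v ∈ C ↔ G.Adj x v ∧ G.Adj y v := by intro v; simp [hC]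
  set W := (G.neighborFinset y).erase x with hW
  have hWm : ∀ v, v ∈ W ↔ v ≠ x ∧ G.Adj y v := by intro v; simp [hW]
  set M := ((G.neighborFinset x).filter (fun v => ¬ G.Adj y v)).erase y with hM
  set S := M.filter (fun v => ∃ w ∈ W, G.Adj w v) with hS
  set A := M.filter (fun v => ¬ ∃ w ∈ W, G.Adj w v) with hA
  have hSm : ∀ v, v ∈ S ↔ G.Adj x v ∧ v ≠ y ∧ ¬ G.Adj y v ∧ ∃ w ∈ W, G.Adj w v := by
    intro v
    simp only [hS, hM, Finset.mem_filter, Finset.mem_erase, SimpleGraph.mem_neighborFinset]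
    tauto
  have hAm : ∀ v, v ∈ A ↔ G.Adj x v ∧ v ≠ y ∧ ¬ G.Adj y v ∧ ¬ ∃ w ∈ W, G.Adj w v := by
    intro v
    simp only [hA, hM, Finset.mem_filter, Finset.mem_erase, SimpleGraph.mem_neighborFinset]
    tauto
  have hcl : ∀ v, G.Adj x v → v = y ∨ v ∈ C ∨ v ∈ S ∨ v ∈ A := by
    intro v hv
    rw [hCm, hSm, hAm]
    by_cases h1 : v = y
    · exact Or.inl h1
    by_cases h2 : G.Adj y v
    · exact Or.inr (Or.inl ⟨hv, h2⟩)
    by_cases h3 : ∃ w ∈ W, G.Adj w v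
    · exact Or.inr (Or.inr (Or.inl ⟨hv, h1, h2, h3⟩))
    · exact Or.inr (Or.inr (Or.inr ⟨hv, h1, h2, h3⟩))
  have hsum : G.degree x = 1 + C.card + S.card + A.card := by
    have e1 := Finset.card_filter_add_card_filter_not (s := G.neighborFinset x)
      (fun v => G.Adj y v)
    have e2 := Finset.card_filter_add_card_filter_not (s := M) (fun v => ∃ w ∈ W, G.Adj w v)
    have e3 : M.card + 1 = ((G.neighborFinset x).filter (fun v => ¬ G.Adj y v)).card :=
      Finset.card_erase_add_one (by simp [hxy])
    rw [G.card_neighborFinset_eq_degree] at e1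
    simp only [← hC, ← hS, ← hA] at e1 e2
    omega
  have hWcard : W.card = G.degree y - 1 := by
    rw [hW, Finset.card_erase_of_mem (by simpa using hxy.symm), G.card_neighborFinset_eq_degree]
  have hCW : C ⊆ W := by
    intro v hv
    rw [hCm] at hv
    rw [hWm]
    exact ⟨hv.1.ne', hv.2⟩
  have hk := hmin y
  have hkc : C.card + 1 ≤ G.degree y := by
    have := Finset.card_le_card hCW
    omega
  have hy1 : G.degree x * (G.degree y - 1) <
      G.degree y * (C.card + S.card + C.card + 2) := by
    have h := star_ineq G hconn hpos hxy W (C ∪ S) (fun b hb => ((hWm b).1 hb).symm) (by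
      intro v hxv hvy h
      rw [Finset.mem_union]
      rcases hcl v hxv with h1 | h1 | h1 | h1
      · exact absurd h1 hvy
      · exact Or.inl h1
      · exact Or.inr h1
      · rw [hAm] at h1
        rcases h with h | h
        · exact absurd h h1.2.2.1
        · exact absurd h h1.2.2.2)
    have e : W.filter (fun b => G.Adj x b) = C := by
      ext v
      rw [Finset.mem_filter, hWm, hCm]
      constructor
      · tauto
      · intro h; exact ⟨⟨h.1.ne', h.2⟩, h.1⟩
    rw [e, hWcard] at h
    refine h.trans_le (Nat.mul_le_mul_left _ ?_)
    have := Finset.card_union_le C S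
    omega
  obtain ⟨T, hT⟩ : ∃ T : ℕ, T = if C.card ≤ 2 then 4 else 3 := ⟨_, rfl⟩
  have hAS : 4 * A.card < T * S.card :=
    num_A _ _ _ _ _ hd hc hk hkc hsum hy1 T hT
  -- the outside region
  obtain ⟨F, hF⟩ : ∃ F : Set V, F = {v | v ≠ x ∧ v ≠ y ∧ v ∉ W ∧ v ∉ S} := ⟨_, rfl⟩
  have hFm : ∀ v, v ∈ F ↔ v ≠ x ∧ v ≠ y ∧ v ∉ W ∧ v ∉ S := by intro v; rw [hF]; rfl
  have hAF : ∀ a ∈ A, a ∈ F := by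
    intro a ha
    rw [hAm] at ha
    rw [hFm, hWm, hSm]
    exact ⟨ha.1.ne', ha.2.1, by tauto, fun h => ha.2.2.2 h.2.2.2⟩
  have hSF : ∀ s ∈ S, s ∉ F := fun s hs h => ((hFm s).1 h).2.2.2 hs
  have hSW : ∀ s ∈ S, s ∉ W := by
    intro s hs; rw [hSm] at hs; rw [hWm]; tauto
  have hWF : ∀ s ∈ W, s ∉ F := fun s hs h => ((hFm s).1 h).2.2.1 hs
  have hxS : x ∉ S := by rw [hSm]; exact fun h => G.irrefl h.1
  have hyS : y ∉ S := by rw [hSm]; tauto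
  have hxW : x ∉ W := by rw [hWm]; tauto
  have hyW : y ∉ W := by rw [hWm]; exact fun h => G.irrefl h.2
  have hxF : x ∉ F := by rw [hFm]; tauto
  have hyF : y ∉ F := by rw [hFm]; tauto
  let Y : Set V := insert y (W : Set V)
  have hYm : ∀ v, v ∈ Y ↔ v = y ∨ v ∈ W := by intro v; simp [Y]
  have hYconn : GConn G Y := GConn.star G y _ (fun s hs => ((hWm s).1 hs).2)
  -- the generic use of the minor lemma
  have hgen : ∀ (r : V) (U : Finset V), (r ∈ S ∨ r ∈ F) →
      (∀ v ∈ U, v ∈ S ∧ v ≠ r ∧ ∃ w, G.Adj v w ∧ FReach G F r w) → U.card ≤ 2 := by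
    intro r U hr hU
    have hR : ∀ b, FReach G F r b → b = r ∨ b ∈ F := fun b hb => hb.mem
    refine k33_card G hpl (GConn.singleton G x) hYconn (FReach.gconn G F r) ?_ ?_ ?_ U ?_
    · rw [Set.disjoint_singleton_left, hYm]
      rintro (h | h)
      · exact hxy.ne h
      · exact hxW h
    · rw [Set.disjoint_singleton_left]
      intro h
      rcases hR x h with h | h
      · rcases hr with hr | hr
        · exact hxS (h ▸ hr)
        · exact hxF (h ▸ hr)
      · exact hxF h
    · rw [Set.disjoint_left]
      intro v hv hv'
      rw [hYm] at hv
      rcases hR v hv' with h | h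
      · subst h
        rcases hv with rfl | hv
        · tauto
        · rcases hr with hr | hr
          · exact hSW _ hr hv
          · exact hWF _ hv hr
      · rcases hv with rfl | hv
        · exact hyF h
        · exact hWF _ hv h
    · intro t ht
      obtain ⟨h1, h2, w, h3, h4⟩ := hU t ht
      have h1' := (hSm t).1 h1
      refine ⟨fun h => hxS (Set.mem_singleton_iff.1 h ▸ h1), ?_, ?_, ⟨x, rfl, h1'.1⟩, ?_,
        ⟨w, h4, h3.symm⟩⟩
      · rw [hYm]
        rintro (h | h)
        · exact hyS (h ▸ h1)
        · exact hSW _ h1 h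
      · intro h
        rcases hR t h with h | h
        · exact h2 h
        · exact hSF _ h1 h
      · obtain ⟨w', hw', hwt⟩ := h1'.2.2.2
        exact ⟨w', (hYm w').2 (Or.inr hw'), hwt⟩
  -- boundary relation
  let N : V → Finset V := fun u => S.filter (fun v => v ≠ u ∧
    (G.Adj u v ∨ ∃ b ∈ F, FReach G F u b ∧ FReach G F v b))
  have hNm : ∀ u v, v ∈ N u ↔ v ∈ S ∧ v ≠ u ∧
      (G.Adj u v ∨ ∃ b ∈ F, FReach G F u b ∧ FReach G F v b) := by
    intro u v; simp only [N, Finset.mem_filter]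
  have hN2 : ∀ u ∈ S, (N u).card ≤ 2 := by
    intro u hu
    refine hgen u _ (Or.inl hu) ?_
    intro v hv
    rw [hNm] at hv
    obtain ⟨h1, h2, h3⟩ := hv
    refine ⟨h1, h2, ?_⟩
    rcases h3 with h3 | ⟨b, hb, h4, h5⟩
    · exact ⟨u, h3.symm, Relation.ReflTransGen.refl⟩
    · obtain ⟨w, hw, hbw⟩ := FReach.front (hSF v h1) hb h5
      exact ⟨w, hw, Relation.ReflTransGen.trans h4 hbw⟩
  have hNsym : ∀ u ∈ S, ∀ v ∈ S, v ∈ N u → u ∈ N v := by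
    intro u hu v hv h
    rw [hNm] at h ⊢
    refine ⟨hu, h.2.1.symm, ?_⟩
    rcases h.2.2 with h3 | ⟨b, hb, h4, h5⟩
    · exact Or.inl h3.symm
    · exact Or.inr ⟨b, hb, h5, h4⟩
  let G3 : V → Finset V := fun u =>
    A.filter (fun a => FReach G F u a ∨ ∃ v ∈ N u, FReach G F v a)
  have hG3m : ∀ u a, a ∈ G3 u ↔ a ∈ A ∧ (FReach G F u a ∨ ∃ v ∈ N u, FReach G F v a) := by
    intro u a; simp only [G3, Finset.mem_filter]
  have hG3sum : ∑ u ∈ S, (G3 u).card ≤ 4 * A.card := by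
    refine g3_count S A N (fun v a => FReach G F v a) hN2
      (fun u _ => Finset.filter_subset _ _) hNsym ?_ ?_
    · intro a ha
      refine hgen a _ (Or.inr (hAF a ha)) ?_
      intro v hv
      rw [Finset.mem_filter] at hv
      exact ⟨hv.1, fun h => hSF _ hv.1 (h ▸ hAF a ha), FReach.front (hSF v hv.1) (hAF a ha) hv.2⟩
    · intro a ha u hu v hv huv h1 h2
      rw [hNm]
      exact ⟨hv, huv.symm, Or.inr ⟨a, hAF a ha, h1, h2⟩⟩
  -- the W side
  let n : V → ℕ := fun z => (S.filter (fun u => G.Adj u z)).card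
  have hzs : ∀ u, ∃ z, u ∈ S → z ∈ W ∧ G.Adj u z ∧ ∀ z' ∈ W, G.Adj u z' → n z' ≤ n z := by
    intro u
    by_cases hu : u ∈ S
    · obtain ⟨w, hw, hwu⟩ := ((hSm u).1 hu).2.2.2
      obtain ⟨z, hz, hz'⟩ := Finset.exists_max_image (W.filter (fun z => G.Adj u z)) n
        ⟨w, Finset.mem_filter.2 ⟨hw, hwu.symm⟩⟩
      rw [Finset.mem_filter] at hz
      exact ⟨z, fun _ => ⟨hz.1, hz.2, fun z' h1 h2 => hz' z' (Finset.mem_filter.2 ⟨h1, h2⟩)⟩⟩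
    · exact ⟨u, fun h => absurd h hu⟩
  choose zs hzs using hzs
  let Sg : V → Finset V := fun u => S.filter (fun s => s ≠ u ∧
    ∃ z ∈ W, z ≠ zs u ∧ G.Adj u z ∧ G.Adj s z)
  have hSgm : ∀ u s, s ∈ Sg u ↔ s ∈ S ∧ s ≠ u ∧ ∃ z ∈ W, z ≠ zs u ∧ G.Adj u z ∧ G.Adj s z := by
    intro u s; simp only [Sg, Finset.mem_filter]
  let W2 := W.filter (fun z => 2 ≤ n z)
  have hW2m : ∀ z, z ∈ W2 ↔ z ∈ W ∧ 2 ≤ n z := by intro z; simp only [W2, Finset.mem_filter]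
  have hE2 : ∀ u ∈ S, (W2.filter (fun z => G.Adj u z)).card ≤ 2 := by
    intro u hu
    have hu' := (hSm u).1 hu
    refine k33_card G hpl (GConn.star G x {s | s ∈ S ∧ s ≠ u} (fun s hs => ((hSm s).1 hs.1).1))
      (GConn.singleton G y) (GConn.singleton G u) ?_ ?_ ?_ _ ?_
    · rw [Set.disjoint_singleton_right]
      rintro (h | h)
      · exact hxy.ne h.symm
      · exact hyS h.1
    · rw [Set.disjoint_singleton_right]
      rintro (h | h)
      · exact hxS (h ▸ hu)
      · exact h.2 rfl
    · rw [Set.disjoint_singleton]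
      exact hu'.2.1.symm
    · intro z hz
      rw [Finset.mem_filter, hW2m] at hz
      obtain ⟨⟨hzW, hn⟩, huz⟩ := hz
      have hzW' := (hWm z).1 hzW
      obtain ⟨s, hs, hsu⟩ := Finset.exists_mem_ne (show 1 < (S.filter (fun u => G.Adj u z)).card from hn) u
      rw [Finset.mem_filter] at hs
      refine ⟨?_, hzW'.2.ne', huz.ne', ⟨s, Or.inr ⟨hs.1, hsu⟩, hs.2⟩, ⟨y, rfl, hzW'.2⟩,
        ⟨u, rfl, huz⟩⟩
      rintro (h | h)
      · exact hzW'.1 h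
      · exact hSW z h.1 hzW
  -- if Sg u is nonempty then there are exactly two big neighbours
  have hSg2 : ∀ u ∈ S, ∀ s ∈ S, s ≠ u → ∀ z ∈ W, z ≠ zs u → G.Adj u z → G.Adj s z →
      W2.filter (fun z => G.Adj u z) = {z, zs u} := by
    intro u hu s hs hsu z hz hzz huz hsz
    have hz2 := hzs u hu
    have hnz : 2 ≤ n z := by
      have : ({u, s} : Finset V) ⊆ S.filter (fun u => G.Adj u z) := by
        intro t ht
        rw [Finset.mem_insert, Finset.mem_singleton] at ht
        rw [Finset.mem_filter]
        rcases ht with rfl | rfl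
        · exact ⟨hu, huz⟩
        · exact ⟨hs, hsz⟩
      have h2 := Finset.card_le_card this
      rwa [Finset.card_pair hsu.symm] at h2
    have hnzs : 2 ≤ n (zs u) := hnz.trans (hz2.2.2 z hz huz)
    symm
    apply Finset.eq_of_subset_of_card_le
    · intro t ht
      rw [Finset.mem_insert, Finset.mem_singleton] at ht
      rw [Finset.mem_filter, hW2m]
      rcases ht with rfl | rfl
      · exact ⟨⟨hz, hnz⟩, huz⟩
      · exact ⟨⟨hz2.1, hnzs⟩, hz2.2.1⟩
    · rw [Finset.card_pair hzz]
      exact hE2 u hu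
  have hSgsum : ∑ u ∈ S, (Sg u).card ≤ S.card := by
    refine sigma_count S W2 G.Adj (fun u => (Sg u).card) hE2 ?_ ?_ ?_ ?_
    · intro z hz
      rw [hW2m] at hz
      have hzW' := (hWm z).1 hz.1
      refine k33_card G hpl (GConn.star G y {w | w ∈ W ∧ w ≠ z} (fun s hs => ((hWm s).1 hs.1).2))
        (GConn.singleton G x) (GConn.singleton G z) ?_ ?_ ?_ _ ?_
      · rw [Set.disjoint_singleton_right]
        rintro (h | h)
        · exact hxy.ne h
        · exact hxW h.1
      · rw [Set.disjoint_singleton_right]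
        rintro (h | h)
        · exact hzW'.2.ne' h
        · exact h.2 rfl
      · rw [Set.disjoint_singleton]
        exact hzW'.1.symm
      · intro u hu
        rw [Finset.mem_filter] at hu
        obtain ⟨hu, huz, hcard⟩ := hu
        obtain ⟨w, hw, hwz⟩ := Finset.exists_mem_ne
          (show 1 < (W2.filter (fun z => G.Adj u z)).card by omega) z
        rw [Finset.mem_filter, hW2m] at hw
        have hu' := (hSm u).1 hu
        refine ⟨?_, hu'.1.ne', huz.ne, ⟨w, Or.inr ⟨hw.1.1, hwz⟩, hw.2.symm⟩, ⟨x, rfl, hu'.1⟩,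
          ⟨z, rfl, huz.symm⟩⟩
        rintro (h | h)
        · exact hu'.2.1 h
        · exact hSW u hu h.1
    · intro z hz
      rw [hW2m] at hz
      exact le_trans (by norm_num) hz.2
    · intro u hu hne
      rw [Finset.card_eq_zero]
      by_contra hemp
      obtain ⟨s, hs⟩ := Finset.nonempty_iff_ne_empty.2 hemp
      obtain ⟨h1, h2, z, h3, h4, h5, h6⟩ := (hSgm u s).1 hs
      have := hSg2 u hu s h1 h2 z h3 h4 h5 h6
      rw [this, Finset.card_pair h4] at hne
      exact hne rfl
    · intro u hu _
      rcases Finset.eq_empty_or_nonempty (Sg u) with hemp | ⟨s, hs⟩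
      · simp [hemp]
      · obtain ⟨h1, h2, z, h3, h4, h5, h6⟩ := (hSgm u s).1 hs
        have hEq := hSg2 u hu s h1 h2 z h3 h4 h5 h6
        rw [hEq, Finset.sum_pair h4]
        have hle : (Sg u).card ≤ n z - 1 := by
          have hu2 : u ∈ S.filter (fun u => G.Adj u z) := Finset.mem_filter.2 ⟨hu, h5⟩
          rw [← Finset.card_erase_of_mem hu2]
          apply Finset.card_le_card
          intro t ht
          obtain ⟨t1, t2, z', t3, t4, t5, t6⟩ := (hSgm u t).1 ht
          have hEq' := hSg2 u hu t t1 t2 z' t3 t4 t5 t6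
          have : z' ∈ ({z, zs u} : Finset V) := by
            rw [← hEq, hEq']; exact Finset.mem_insert_self _ _
          rw [Finset.mem_insert, Finset.mem_singleton] at this
          have hz' : z' = z := by tauto
          rw [Finset.mem_erase, Finset.mem_filter]
          exact ⟨t2, t1, hz' ▸ t6⟩
        have h7 : n z ≤ n (zs u) := (hzs u hu).2.2 z h3 h5
        have h8 : n z = (S.filter (fun u => G.Adj u z)).card := rfl
        have h9 : n (zs u) = (S.filter (fun v => G.Adj v (zs u))).card := rfl
        omega
  -- a good vertex u
  obtain ⟨u, hu, hgood⟩ : ∃ u ∈ S, (G3 u).card + (Sg u).card ≤ T := by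
    by_contra hcon
    push Not at hcon
    have h1 : S.card • (T + 1) ≤ ∑ u ∈ S, ((G3 u).card + (Sg u).card) :=
      Finset.card_nsmul_le_sum _ _ _ (fun u hu => hcon u hu)
    rw [Finset.sum_add_distrib, smul_eq_mul, mul_add, mul_one, mul_comm] at h1
    omega
  have hu' := (hSm u).1 hu
  have hz := hzs u hu
  have hzx : zs u ≠ x := ((hWm _).1 hz.1).1
  have hCu : (C.filter (fun v => G.Adj u v)).card ≤ 2 := by
    refine k33_card G hpl (GConn.singleton G x) (GConn.singleton G y) (GConn.singleton G u)
      ?_ ?_ ?_ _ ?_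
    · rw [Set.disjoint_singleton]; exact hxy.ne
    · rw [Set.disjoint_singleton]; exact hu'.1.ne
    · rw [Set.disjoint_singleton]; exact hu'.2.1.symm
    · intro v hv
      rw [Finset.mem_filter, hCm] at hv
      exact ⟨hv.1.1.ne', hv.1.2.ne', hv.2.ne', ⟨x, rfl, hv.1.1⟩, ⟨y, rfl, hv.1.2⟩, ⟨u, rfl, hv.2⟩⟩
  obtain ⟨B, hB⟩ : ∃ B, B = ((G.neighborFinset u).erase x).erase (zs u) := ⟨_, rfl⟩
  have hBm : ∀ b, b ∈ B ↔ b ≠ zs u ∧ b ≠ x ∧ G.Adj u b := by intro b; simp [hB]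
  have hBcard : B.card = G.degree u - 2 := by
    rw [hB, Finset.card_erase_of_mem (by simp [hzx, hz.2.1]),
      Finset.card_erase_of_mem (by simpa using hu'.1.symm), G.card_neighborFinset_eq_degree]
    omega
  have hBcl : ∀ b ∈ B, b ∈ W ∨ b ∈ S ∨ b ∈ F := by
    intro b hb
    rw [hBm] at hb
    have : b ≠ y := by rintro rfl; exact hu'.2.2.1 hb.2.2.symm
    rw [hFm]
    tauto
  have hWA : ∀ w ∈ W, ∀ a ∈ A, ¬ G.Adj w a := by
    intro w hw a ha h
    exact ((hAm a).1 ha).2.2.2 ⟨w, hw, h⟩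
  have hSgW : ∀ b ∈ B, b ∈ W → ∀ v ∈ S, v ≠ u → G.Adj b v → v ∈ Sg u := by
    intro b hb hbW v hv hvu hbv
    rw [hBm] at hb
    rw [hSgm]
    exact ⟨hv, hvu, b, hbW, hb.1, hb.2.2, hbv.symm⟩
  have hNadj : ∀ b ∈ S, ∀ v ∈ S, G.Adj b v → v ∈ N b := by
    intro b _ v hv h
    rw [hNm]; exact ⟨hv, h.ne', Or.inl h⟩
  have hG3u : ∀ a ∈ A, G.Adj u a → a ∈ G3 u := by
    intro a ha h
    rw [hG3m]; exact ⟨ha, Or.inl (Relation.ReflTransGen.single ⟨h, hAF a ha⟩)⟩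
  have hG3S : ∀ b ∈ S, G.Adj u b → ∀ a ∈ A, G.Adj b a → a ∈ G3 u := by
    intro b hb hub a ha h
    rw [hG3m]
    exact ⟨ha, Or.inr ⟨b, hNadj u hu b hb hub, Relation.ReflTransGen.single ⟨h, hAF a ha⟩⟩⟩
  have hG3F : ∀ b ∈ F, G.Adj u b → ∀ a ∈ A, G.Adj b a → a ∈ G3 u := by
    intro b hb hub a ha h
    rw [hG3m]
    exact ⟨ha, Or.inl ((Relation.ReflTransGen.single ⟨hub, hb⟩).tail ⟨h, hAF a ha⟩)⟩
  have hNF : ∀ b ∈ F, G.Adj u b → ∀ v ∈ S, v ≠ u → G.Adj b v → v ∈ N u := by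
    intro b hb hub v hv hvu h
    rw [hNm]
    exact ⟨hv, hvu, Or.inr ⟨b, hb, Relation.ReflTransGen.single ⟨hub, hb⟩,
      Relation.ReflTransGen.single ⟨h.symm, hb⟩⟩⟩
  have hNe : ∀ v ∈ N u, ((N v).erase u).card ≤ 1 := by
    intro v hv
    have hvS := ((hNm u v).1 hv).1
    have := hNsym u hu v hvS hv
    rw [Finset.card_erase_of_mem this]
    have := hN2 v hvS
    omega
  have hBadj : ∀ b ∈ B, G.Adj u b ∧ b ≠ x := by
    intro b hb; rw [hBm] at hb; exact ⟨hb.2.2, hb.2.1⟩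
  -- the general inequality
  have hgenP := star_ineq G hconn hpos hu'.1 B
    (({y} ∪ C ∪ Sg u ∪ N u ∪ (N u).biUnion (fun v => (N v).erase u)) ∪ G3 u) hBadj (by
      intro v hxv hvu h
      simp only [Finset.mem_union, Finset.mem_singleton, Finset.mem_biUnion, Finset.mem_erase]
      rcases hcl v hxv with h1 | h1 | h1 | h1
      · simp [h1]
      · simp [h1]
      · rcases h with h | ⟨b, hb, hbv⟩
        · have := hNadj u hu v h1 h; simp [this]
        · have hb' := hBadj b hb
          rcases hBcl b hb with hb1 | hb1 | hb1
          · have := hSgW b hb hb1 v h1 hvu hbv; simp [this]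
          · have := hNadj b hb1 v h1 hbv
            exact Or.inl (Or.inr ⟨b, hNadj u hu b hb1 hb'.1, hvu, this⟩)
          · have := hNF b hb1 hb'.1 v h1 hvu hbv; simp [this]
      · right
        rcases h with h | ⟨b, hb, hbv⟩
        · exact hG3u v h1 h
        · have hb' := hBadj b hb
          rcases hBcl b hb with hb1 | hb1 | hb1
          · exact absurd hbv (hWA b hb1 v h1)
          · exact hG3S b hb1 hb'.1 v h1 hbv
          · exact hG3F b hb1 hb'.1 v h1 hbv)
  have hPcard : (({y} ∪ C ∪ Sg u ∪ N u ∪ (N u).biUnion (fun v => (N v).erase u)) ∪ G3 u).card ≤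
      1 + C.card + (Sg u).card + 2 + 2 + (G3 u).card := by
    have b1 : ((N u).biUnion (fun v => (N v).erase u)).card ≤ 2 := by
      refine Finset.card_biUnion_le.trans ((Finset.sum_le_card_nsmul _ _ 1 hNe).trans ?_)
      have := hN2 u hu
      simp only [smul_eq_mul]; omega
    have b2 := hN2 u hu
    refine (Finset.card_union_le _ _).trans ?_
    gcongr
    refine (Finset.card_union_le _ _).trans ?_
    gcongr
    refine (Finset.card_union_le _ _).trans ?_
    gcongr
    refine (Finset.card_union_le _ _).trans ?_
    gcongr
    refine (Finset.card_union_le _ _).trans ?_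
    simp
  have hh1 : (B.filter (fun b => G.Adj x b)).card ≤ B.card := Finset.card_filter_le _ _
  have hh2 : (B.filter (fun b => G.Adj x b)).card ≤ 4 + (G3 u).card := by
    have hsub : B.filter (fun b => G.Adj x b) ⊆ C.filter (fun v => G.Adj u v) ∪ N u ∪ G3 u := by
      intro b hb
      rw [Finset.mem_filter] at hb
      have hb' := hBadj b hb.1
      rw [Finset.mem_union, Finset.mem_union, Finset.mem_filter]
      rcases hcl b hb.2 with h1 | h1 | h1 | h1
      · subst h1; exact absurd hb'.1.symm hu'.2.2.1
      · exact Or.inl (Or.inl ⟨h1, hb'.1⟩)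
      · exact Or.inl (Or.inr (hNadj u hu b h1 hb'.1))
      · exact Or.inr (hG3u b h1 hb'.1)
    have b2 := hN2 u hu
    have := (Finset.card_le_card hsub).trans (Finset.card_union_le _ _)
    have := Finset.card_union_le (C.filter (fun v => G.Adj u v)) (N u)
    omega
  rw [hBcard] at hgenP hh1
  refine num_final (G.degree x) (G.degree u) C.card (G3 u).card (Sg u).card T hd hc hT hgood
    (hmin u) ?_ ?_ ?_
  · intro hk3
    have hB1 : B.card = 1 := by rw [hBcard]; omega
    obtain ⟨b, hb⟩ := Finset.card_eq_one.1 hB1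
    have hbB : b ∈ B := by rw [hb]; exact Finset.mem_singleton_self _
    have hbu := hBadj b hbB
    have hNu : ∀ v, G.Adj x v → G.Adj u v → v ∈ C ∨ v = b := by
      intro v hxv huv
      by_cases h1 : v = zs u
      · left
        rw [hCm]
        exact ⟨hxv, by rw [h1]; exact ((hWm _).1 hz.1).2⟩
      · right
        have : v ∈ B := by rw [hBm]; exact ⟨h1, hxv.ne', huv⟩
        rwa [hb, Finset.mem_singleton] at this
    have fin : ∀ P : Finset V, (∀ v, G.Adj x v → v ≠ u → (v ∈ C ∨ v = b ∨ G.Adj b v) → v ∈ P) →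
        P.card ≤ 2 + C.card + (G3 u).card + (Sg u).card →
        G.degree x < 3 * (5 + C.card + (G3 u).card + (Sg u).card) := by
      intro P hP hPc
      have := star_ineq G hconn hpos hu'.1 B P hBadj (by
        intro v hxv hvu h
        apply hP v hxv hvu
        rcases h with h | ⟨b', hb', h⟩
        · rcases hNu v hxv h with h | h
          · exact Or.inl h
          · exact Or.inr (Or.inl h)
        · rw [hb, Finset.mem_singleton] at hb'
          exact Or.inr (Or.inr (hb' ▸ h)))
      rw [hBcard, hk3] at this
      rw [hk3] at hh1
      omega
    rcases hBcl b hbB with hb1 | hb1 | hb1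
    · refine fin ({y} ∪ C ∪ Sg u) ?_ ?_
      · intro v hxv hvu h
        simp only [Finset.mem_union, Finset.mem_singleton]
        rcases h with h | h | h
        · simp [h]
        · have : v ∈ C := by rw [hCm]; exact ⟨hxv, by rw [h]; exact ((hWm _).1 hb1).2⟩
          simp [this]
        · rcases hcl v hxv with h1 | h1 | h1 | h1
          · simp [h1]
          · simp [h1]
          · have := hSgW b hbB hb1 v h1 hvu h; simp [this]
          · exact absurd h (hWA b hb1 v h1)
      · have c1 := Finset.card_union_le ({y} ∪ C) (Sg u)
        have c2 := Finset.card_union_le {y} C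
        rw [Finset.card_singleton] at c2
        omega
    · have hbN := hNadj u hu b hb1 hbu.1
      refine fin ({b} ∪ C ∪ (N b).erase u ∪ G3 u) ?_ ?_
      · intro v hxv hvu h
        simp only [Finset.mem_union, Finset.mem_singleton, Finset.mem_erase]
        rcases h with h | h | h
        · simp [h]
        · simp [h]
        · rcases hcl v hxv with h1 | h1 | h1 | h1
          · subst h1; exact absurd h.symm ((hSm b).1 hb1).2.2.1
          · simp [h1]
          · have := hNadj b hb1 v h1 h; simp [this, hvu]
          · have := hG3S b hb1 hbu.1 v h1 h; simp [this]
      · have c0 := Finset.card_union_le ({b} ∪ C ∪ (N b).erase u) (G3 u)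
        have c1 := Finset.card_union_le ({b} ∪ C) ((N b).erase u)
        have c2 := Finset.card_union_le {b} C
        have c3 := hNe b hbN
        rw [Finset.card_singleton] at c2
        omega
    · refine fin (C ∪ N u ∪ G3 u) ?_ ?_
      · intro v hxv hvu h
        simp only [Finset.mem_union]
        rcases hcl v hxv with h1 | h1 | h1 | h1
        · subst h1
          rcases h with h | h | h
          · simp [h]
          · exact absurd (h ▸ hb1) hyF
          · exact absurd ((hWm b).2 ⟨hbu.2, h.symm⟩) ((hFm b).1 hb1).2.2.1
        · simp [h1]
        · rcases h with h | h | h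
          · simp [h]
          · exact absurd (h ▸ hb1) (hSF v h1)
          · have := hNF b hb1 hbu.1 v h1 hvu h; simp [this]
        · rcases h with h | h | h
          · simp [h]
          · have := hG3u v h1 (h ▸ hbu.1); simp [this]
          · have := hG3F b hb1 hbu.1 v h1 h; simp [this]
      · have c0 := Finset.card_union_le (C ∪ N u) (G3 u)
        have c1 := Finset.card_union_le C (N u)
        have c3 := hN2 u hu
        omega
  · intro hk4
    rw [hk4] at hgenP hh1
    omega
  · refine hgenP.trans_le (Nat.mul_le_mul_left _ ?_)
    omega

/-- numerator–denominator pairs of the fractions in `[-1,1]` with small denominators -/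
noncomputable def frPairs (N : ℕ) : Finset (ℤ × ℕ) :=
  Finset.Icc (-(N : ℤ)) N ×ˢ Finset.Icc 1 N

/-- coprime pairs -/
def frPosPairs (N : ℕ) : Finset (ℕ × ℕ) :=
  (Finset.Icc 1 N ×ˢ Finset.Icc 1 N).filter (fun p => p.1 ≤ p.2 ∧ Nat.Coprime p.1 p.2)

lemma frPairs_card (N : ℕ) : (frPairs N).card = (2 * N + 1) * N := by
  rw [frPairs, Finset.card_product, Int.card_Icc, Nat.card_Icc]
  congr 1
  omega

lemma frPosPairs_card : (frPosPairs 36).card ≤ 396 := by decide +kernel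

/-- fractions in `[-1,1]` with denominators at most `N` -/
noncomputable def fr (N : ℕ) : Finset ℚ := (frPairs N).image (fun p => (p.1 : ℚ) / p.2)

lemma fr_card (N : ℕ) : (fr N).card ≤ (2 * N + 1) * N :=
  Finset.card_image_le.trans (frPairs_card N).le

lemma mem_fr (N : ℕ) (L : ℤ) (d : ℕ) (hd : 0 < d) (hd' : d ≤ N) (h : |L| ≤ d) : (L : ℚ) / d ∈ fr N := by
  rw [abs_le] at h
  refine Finset.mem_image.2 ⟨(L, d), ?_, rfl⟩
  simp only [frPairs, Finset.mem_product, Finset.mem_Icc]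
  omega

lemma fr_pos_card (N M : ℕ) (hM : (frPosPairs N).card ≤ M) : (((fr N).filter (fun q => q ≤ 1)).filter (fun q => 0 < q)).card ≤ M := by
  have : ((fr N).filter (fun q => q ≤ 1)).filter (fun q => 0 < q) ⊆
      (frPosPairs N).image (fun p => (p.1 : ℚ) / p.2) := by
    intro q hq
    simp only [Finset.mem_filter] at hq
    obtain ⟨⟨hq1, hq2⟩, hq3⟩ := hq
    obtain ⟨⟨L, d⟩, hLd, rfl⟩ := Finset.mem_image.1 hq1
    simp only [frPairs, Finset.mem_product, Finset.mem_Icc] at hLd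
    simp only at hq2 hq3
    set q : ℚ := (L : ℚ) / d with hq
    have hd : (0 : ℤ) < d := by omega
    have hden : q.den ≤ N := by
      have : (q.den : ℤ) ∣ d := by
        have := Rat.den_dvd L d
        simpa [hq, Rat.divInt_eq_div] using this
      have := Int.le_of_dvd hd this
      omega
    have hnum : 0 < q.num := Rat.num_pos.2 hq3
    have hle : q.num ≤ q.den := by
      have := Rat.num_div_den q
      have hp : (0 : ℚ) < q.den := by exact_mod_cast q.den_pos
      have h2 : (q.num : ℚ) ≤ q.den := by
        rw [← this, div_le_one hp] at hq2
        exact hq2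
      exact_mod_cast h2
    refine Finset.mem_image.2 ⟨(q.num.natAbs, q.den), ?_, ?_⟩
    · have := q.den_pos
      simp only [frPosPairs, Finset.mem_filter, Finset.mem_product, Finset.mem_Icc]
      refine ⟨⟨⟨by omega, by omega⟩, by omega, by omega⟩, by omega, q.reduced⟩
    · have h3 : ((q.num.natAbs : ℕ) : ℚ) = q.num := by
        have : ((q.num.natAbs : ℕ) : ℤ) = q.num := by omega
        rw [← Int.cast_natCast, this]
      simp only
      rw [h3, Rat.num_div_den]
  exact (Finset.card_le_card this).trans (Finset.card_image_le.trans hM)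

lemma dist_pred (G : SimpleGraph V) (hconn : G.Connected) (x v : V) (n : ℕ)
    (h : G.dist x v = n + 1) : ∃ u, G.Adj u v ∧ G.dist x u = n := by
  obtain ⟨w, hw⟩ := hconn.exists_walk_length_eq_dist v x
  rw [SimpleGraph.dist_comm, h] at hw
  cases w with
  | nil => simp at hw
  | @cons _ u _ hu p =>
    refine ⟨u, hu.symm, ?_⟩
    simp only [SimpleGraph.Walk.length_cons] at hw
    have h1 : G.dist u x ≤ p.length := SimpleGraph.dist_le p
    have h2 : G.dist x v ≤ G.dist x u + G.dist u v := hconn.dist_triangle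
    rw [SimpleGraph.dist_eq_one_iff_adj.2 hu.symm] at h2
    rw [SimpleGraph.dist_comm] at h1
    omega

lemma dist_adj (G : SimpleGraph V) (hconn : G.Connected) (x u v : V) (h : G.Adj u v) :
    G.dist x v ≤ G.dist x u + 1 := by
  have h2 : G.dist x v ≤ G.dist x u + G.dist u v := hconn.dist_triangle
  rwa [SimpleGraph.dist_eq_one_iff_adj.2 h] at h2

theorem finite_of_degree_le (N M : ℕ) (G : SimpleGraph V) [G.LocallyFinite]
    (hconn : G.Connected) (hmin : ∀ u : V, 3 ≤ G.degree u) (hpos : PositivelyCurved G)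
    (hmax : ∀ u : V, G.degree u ≤ N)
    (hM : (frPosPairs N).card ≤ M) :
    Finite V ∧ Nat.card V ≤ ((2 * N + 1) * N + 1) * N ^ (M + 1) := by
  classical
  obtain ⟨x0⟩ := hconn.nonempty
  let D : V → ℕ := fun v => G.dist x0 v
  have hD0 : ∀ v, D v = 0 → v = x0 := fun v hv =>
    ((hconn.dist_eq_zero_iff).1 hv).symm
  have hDa : ∀ u v, G.Adj u v → D v ≤ D u + 1 := fun u v h => dist_adj G hconn x0 u v h
  let L : V → ℤ := fun v => ∑ w ∈ G.neighborFinset v, ((D w : ℤ) - D v)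
  have hL : ∀ v, |L v| ≤ G.degree v := by
    intro v
    rw [← SimpleGraph.card_neighborFinset_eq_degree]
    refine (Finset.abs_sum_le_sum_abs _ _).trans ?_
    refine (Finset.sum_le_card_nsmul _ _ 1 ?_).trans (by simp)
    intro w hw
    have hw' : G.Adj v w := by simpa using hw
    have h1 := hDa _ _ hw'
    have h2 := hDa _ _ hw'.symm
    rw [abs_le]; omega
  let a : V → ℚ := fun v => (L v : ℚ) / G.degree v
  have hN : 0 < N := by have := hmin x0; have := hmax x0; omega
  have hdp : ∀ v, 0 < G.degree v := fun v => by have := hmin v; omega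
  have hafr : ∀ v, a v ∈ fr N := fun v => mem_fr N _ _ (hdp v) (hmax v) (hL v)
  have ha1 : ∀ v, a v ≤ 1 := by
    intro v
    have h0 : (0 : ℚ) < G.degree v := by exact_mod_cast hdp v
    have h1 := (abs_le.1 (hL v)).2
    have h2 : (L v : ℚ) ≤ G.degree v := by exact_mod_cast h1
    exact (div_le_one h0).2 h2
  have hdec : ∀ u v, G.Adj u v → D v = D u + 1 → a v < a u := by
    intro u v huv hD
    have := curv_ineq G hconn hpos huv (fun w => (D w : ℤ))
      (fun p q hpq => by have := hDa _ _ hpq; omega) (by simp [hD])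
    have hu : (0 : ℚ) < G.degree u := by exact_mod_cast hdp u
    have hv : (0 : ℚ) < G.degree v := by exact_mod_cast hdp v
    rw [div_lt_div_iff₀ hv hu]
    have h2 : ((G.degree u * L v : ℤ) : ℚ) < ((G.degree v * L u : ℤ) : ℚ) := Int.cast_lt.2 this
    push_cast at h2
    linarith
  have hcount : ∀ n v, D v = n →
      n ≤ (((fr N).filter (fun q => q ≤ 1)).filter (fun q => a v < q)).card := by
    intro n
    induction n with
    | zero => intro v _; exact Nat.zero_le _
    | succ n ih =>
      intro v hv
      obtain ⟨u, huv, hu⟩ := dist_pred G hconn x0 v n hv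
      have h1 := ih u hu
      have h2 := hdec u v huv (by rw [hv]; simp only [D, hu])
      refine lt_of_le_of_lt h1 (Finset.card_lt_card ?_)
      refine Finset.ssubset_iff_subset_ne.2 ⟨?_, ?_⟩
      · intro q hq
        rw [Finset.mem_filter] at hq ⊢
        exact ⟨hq.1, h2.trans hq.2⟩
      · intro heq
        have : a u ∈ ((fr N).filter (fun q => q ≤ 1)).filter (fun q => a v < q) := by
          rw [Finset.mem_filter, Finset.mem_filter]
          exact ⟨⟨hafr u, ha1 u⟩, h2⟩
        rw [← heq, Finset.mem_filter] at this
        exact lt_irrefl _ this.2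
  have hDle : ∀ v, D v ≤ (2 * N + 1) * N := fun v => (hcount _ v rfl).trans
    ((Finset.card_filter_le _ _).trans ((Finset.card_filter_le _ _).trans (fr_card N)))
  have hLneg : ∀ v, M < D v → L v ≤ 0 := by
    intro v hv
    by_contra hc
    push Not at hc
    have hpos' : 0 < a v := by
      have h0 : (0 : ℚ) < G.degree v := by exact_mod_cast hdp v
      have : (0 : ℚ) < L v := by exact_mod_cast hc
      exact div_pos this h0
    have h1 := hcount _ v rfl
    have h2 : (((fr N).filter (fun q => q ≤ 1)).filter (fun q => a v < q)).card ≤ M := by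
      refine (Finset.card_le_card ?_).trans (fr_pos_card N M hM)
      intro q hq
      rw [Finset.mem_filter] at hq ⊢
      exact ⟨hq.1, hpos'.trans hq.2⟩
    omega
  -- level sets
  let S : ℕ → Finset V := fun r => Nat.rec {x0}
    (fun r T => (T.biUnion (fun u => G.neighborFinset u)).filter (fun v => D v = r + 1)) r
  have hS : ∀ r v, v ∈ S r ↔ D v = r := by
    intro r
    induction r with
    | zero =>
      intro v
      show v ∈ ({x0} : Finset V) ↔ _
      rw [Finset.mem_singleton]
      exact ⟨fun h => by simp [D, h], hD0 v⟩
    | succ r ih =>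
      intro v
      show v ∈ ((S r).biUnion (fun u => G.neighborFinset u)).filter (fun v => D v = r + 1) ↔ _
      rw [Finset.mem_filter, Finset.mem_biUnion]
      refine ⟨fun h => h.2, fun h => ⟨?_, h⟩⟩
      obtain ⟨u, huv, hu⟩ := dist_pred G hconn x0 v r h
      exact ⟨u, (ih u).2 hu, by simpa using huv⟩
  let E : ℕ → ℕ := fun r => ∑ u ∈ S r, ((S (r + 1)).filter (fun w => G.Adj u w)).card
  have hE1 : ∀ r, (S (r + 1)).card ≤ E r := by
    intro r
    have : S (r + 1) ⊆ (S r).biUnion (fun u => (S (r + 1)).filter (fun w => G.Adj u w)) := by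
      intro v hv
      obtain ⟨u, huv, hu⟩ := dist_pred G hconn x0 v r ((hS _ _).1 hv)
      rw [Finset.mem_biUnion]
      exact ⟨u, (hS _ _).2 hu, Finset.mem_filter.2 ⟨hv, huv⟩⟩
    exact (Finset.card_le_card this).trans Finset.card_biUnion_le
  have hE2 : ∀ r, E r ≤ N * (S r).card := by
    intro r
    refine (Finset.sum_le_card_nsmul _ _ N ?_).trans (by simp [mul_comm])
    intro u _
    refine le_trans (Finset.card_le_card ?_) ((G.card_neighborFinset_eq_degree u).le.trans (hmax u))
    intro w hw
    simpa using (Finset.mem_filter.1 hw).2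
  have hE3 : ∀ r, M ≤ r → E (r + 1) ≤ E r := by
    intro r hr
    have hsw : E r = ∑ w ∈ S (r + 1), ((S r).filter (fun u => G.Adj u w)).card :=
      Finset.sum_card_bipartiteAbove_eq_sum_card_bipartiteBelow G.Adj
    rw [hsw]
    apply Finset.sum_le_sum
    intro v hv
    have hDv : D v = r + 1 := (hS _ _).1 hv
    have hneg := hLneg v (by omega)
    have e1 : L v = ∑ w ∈ G.neighborFinset v,
        ((if D w = r + 2 then (1 : ℤ) else 0) - (if D w = r then (1 : ℤ) else 0)) := by
      apply Finset.sum_congr rfl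
      intro w hw
      have hw' : G.Adj v w := by simpa using hw
      have h1 := hDa _ _ hw'
      have h2 := hDa _ _ hw'.symm
      rw [hDv]
      rcases (by omega : D w = r ∨ D w = r + 1 ∨ D w = r + 2) with h | h | h <;> simp [h]
    rw [Finset.sum_sub_distrib, Finset.sum_boole, Finset.sum_boole] at e1
    have f1 : (S (r + 1 + 1)).filter (fun w => G.Adj v w) =
        (G.neighborFinset v).filter (fun w => D w = r + 2) := by
      ext w
      simp only [Finset.mem_filter, hS, SimpleGraph.mem_neighborFinset]
      tauto
    have f2 : (S r).filter (fun w => G.Adj w v) =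
        (G.neighborFinset v).filter (fun w => D w = r) := by
      ext w
      simp only [Finset.mem_filter, hS, SimpleGraph.mem_neighborFinset, G.adj_comm v w]
      tauto
    rw [f1, f2]
    have : ((((G.neighborFinset v).filter (fun w => D w = r + 2)).card : ℕ) : ℤ) ≤
      (((G.neighborFinset v).filter (fun w => D w = r)).card : ℕ) := by linarith
    exact_mod_cast this
  have hc1 : ∀ r, (S r).card ≤ N ^ r := by
    intro r
    induction r with
    | zero => simp [S]
    | succ r ih =>
      calc (S (r + 1)).card ≤ N * (S r).card := (hE1 r).trans (hE2 r)
        _ ≤ N * N ^ r := by gcongr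
        _ = N ^ (r + 1) := by ring
  have hc2 : ∀ k, E (M + k) ≤ N ^ (M + 1) := by
    intro k
    induction k with
    | zero =>
      calc E M ≤ N * (S M).card := hE2 _
        _ ≤ N * N ^ M := by gcongr; exact hc1 M
        _ = N ^ (M + 1) := by ring
    | succ k ih => exact (hE3 (M + k) (Nat.le_add_right M k)).trans ih
  have hc3 : ∀ r, (S r).card ≤ N ^ (M + 1) := by
    intro r
    rcases Nat.lt_or_ge M r with h | h
    · obtain ⟨k, rfl⟩ : ∃ k, r = M + k + 1 := ⟨r - (M + 1), by omega⟩
      exact (hE1 _).trans (hc2 k)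
    · exact (hc1 r).trans (Nat.pow_le_pow_right hN (by omega))
  let B : Finset V := (Finset.range ((2 * N + 1) * N + 1)).biUnion S
  have hB : ∀ v, v ∈ B := fun v => by
    rw [Finset.mem_biUnion]
    exact ⟨D v, by rw [Finset.mem_range]; exact Nat.lt_succ_of_le (hDle v), (hS _ _).2 rfl⟩
  have hfin : Finite V := Set.finite_univ_iff.1 (B.finite_toSet.subset (fun v _ => hB v))
  refine ⟨hfin, ?_⟩
  have := Fintype.ofFinite V
  rw [Nat.card_eq_fintype_card, ← Finset.card_univ]
  calc (Finset.univ : Finset V).card ≤ B.card := Finset.card_le_card (fun v _ => hB v)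
    _ ≤ ∑ r ∈ Finset.range ((2 * N + 1) * N + 1), (S r).card := Finset.card_biUnion_le
    _ ≤ ∑ r ∈ Finset.range ((2 * N + 1) * N + 1), N ^ (M + 1) := Finset.sum_le_sum (fun r _ => hc3 r)
    _ = ((2 * N + 1) * N + 1) * N ^ (M + 1) := by
      rw [Finset.sum_const, Finset.card_range, smul_eq_mul]

set_option exponentiation.threshold 1000 in
lemma final_numeric : ((2 * 36 + 1) * 36 + 1) * 36 ^ (396 + 1) ≤ 17 ^ 544 := by norm_num

/-- A simple connected positively curved planar graph with minimum degree at least 3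
is finite, with at most `17 ^ 544` vertices. -/
theorem finite_of_positively_curved_planar (G : SimpleGraph V) [G.LocallyFinite]
    (hconn : G.Connected) (hplanar : IsPlanar G)
    (hmin : ∀ u : V, 3 ≤ G.degree u) (hpos : PositivelyCurved G) :
    Finite V ∧ Nat.card V ≤ 17 ^ 544 := by
  obtain ⟨h1, h2⟩ := finite_of_degree_le 36 396 G hconn hmin hpos
    (fun u => degree_le_36 G hconn hplanar hmin hpos u) frPosPairs_card
  exact ⟨h1, h2.trans final_numeric⟩
end

section
/- Let G be a simple connected positively curved (in the Lin–Lu–Yau sense) graph. Then for every edge xy of G, κ_LLY(x,y) ≥ 1/(deg(x)·deg(y)). -/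
open Filter Set

variable {V : Type*}

open Classical in
lemma aux_push {ι W : Type*} [Fintype ι] (t : ι → W) (f : W → ℝ)
    (hf : ∀ w, w ∉ Set.range t → f w = 0) :
    ∑ j, f (t j) / (∑ k, if t k = t j then (1:ℝ) else 0) = ∑ᶠ w, f w := by
  rw [finsum_eq_sum_of_support_subset (s := Finset.univ.image t) f]
  · rw [← Finset.sum_fiberwise_of_maps_to (s := Finset.univ) (t := Finset.univ.image t) (g := t)
      (fun i _ => Finset.mem_image_of_mem _ (Finset.mem_univ _))]
    refine Finset.sum_congr rfl fun w hw => ?_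
    obtain ⟨i, -, rfl⟩ := Finset.mem_image.1 hw
    have h1 : ∀ j ∈ Finset.univ.filter (fun j => t j = t i),
        f (t j) / (∑ k, if t k = t j then (1:ℝ) else 0)
        = f (t i) / (∑ k, if t k = t i then (1:ℝ) else 0) := by
      intro j hj
      rw [(Finset.mem_filter.1 hj).2]
    rw [Finset.sum_congr rfl h1, Finset.sum_const, nsmul_eq_mul, Finset.sum_boole]
    have : (((Finset.univ.filter (fun j => t j = t i)).card : ℕ) : ℝ) ≠ 0 := by
      have : 0 < (Finset.univ.filter (fun j => t j = t i)).card :=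
        Finset.card_pos.2 ⟨i, by simp⟩
      positivity
    field_simp
  · intro w hw
    by_contra h
    exact hw (hf w (by simpa using h))

open Classical in
lemma aux_single {W : Type*} (a : W) (c : W → ℝ) :
    ∑ᶠ w, (if a = w then c w else 0) = c a := by
  rw [finsum_eq_single _ a (fun w hw => if_neg (Ne.symm hw)), if_pos rfl]

lemma aux_supp_single {W : Type*} [DecidableEq W] (a : W) (c : W → ℝ) :
    (Function.support fun w => (if a = w then c w else 0)).Finite := by
  refine (Set.finite_singleton a).subset fun w hw => ?_
  by_contra h
  exact hw (if_neg (Ne.symm h))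

open Classical in
lemma aux_finsum {ι W : Type*} [Fintype ι] (a : ι → W) (c : ι → W → ℝ) :
    ∑ᶠ w, ∑ i, (if a i = w then c i w else 0) = ∑ i, c i (a i) := by
  rw [finsum_sum_comm]
  · exact Finset.sum_congr rfl fun i _ => aux_single _ _
  · intro i _
    exact aux_supp_single _ _

open Classical in
lemma aux_perm {ι : Type*} [Fintype ι] [Nonempty ι] (G : SimpleGraph V)
    (s t : ι → V) (m₁ m₂ : V → ℝ)
    (h₁ : ∀ u, m₁ u = (∑ i, if s i = u then (1:ℝ) else 0) / Fintype.card ι)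
    (h₂ : ∀ u, m₂ u = (∑ i, if t i = u then (1:ℝ) else 0) / Fintype.card ι)
    (σ : Equiv.Perm ι) :
    ∃ A : V → V → ℝ, IsCoupling m₁ m₂ A ∧
      (∑ i, (G.dist (s i) (t (σ i)) : ℝ)) / Fintype.card ι
        = ∑ᶠ p : V × V, A p.1 p.2 * (G.dist p.1 p.2 : ℝ) := by
  have hN : (0:ℝ) < Fintype.card ι := by exact_mod_cast Fintype.card_pos
  refine ⟨fun u v => ∑ i, if (s i, t (σ i)) = (u, v) then (1:ℝ) / Fintype.card ι else 0,
    ⟨?_, ?_, ?_, ?_⟩, ?_⟩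
  · refine (Set.finite_range (fun i => (s i, t (σ i)))).subset fun p hp => ?_
    by_contra h
    refine hp (Finset.sum_eq_zero fun i _ => if_neg fun e => h ⟨i, e⟩)
  · intro u v
    constructor
    · exact Finset.sum_nonneg fun i _ => by split_ifs <;> positivity
    · calc _ ≤ ∑ i : ι, (1:ℝ) / Fintype.card ι :=
            Finset.sum_le_sum fun i _ => by split_ifs <;> [exact le_rfl; positivity]
        _ = 1 := by simp [hN.ne']
  · intro u
    rw [h₁, Finset.sum_div]
    have := aux_finsum (fun i => t (σ i))
      (fun i _ => if s i = u then (1:ℝ) / Fintype.card ι else 0)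
    calc _ = ∑ᶠ w, ∑ i, (if t (σ i) = w then
              (if s i = u then (1:ℝ) / Fintype.card ι else 0) else 0) := by
            refine finsum_congr fun w => Finset.sum_congr rfl fun i _ => ?_
            simp only [Prod.mk.injEq]; split_ifs <;> simp_all
      _ = _ := by rw [this]; refine Finset.sum_congr rfl fun i _ => ?_
                  split_ifs <;> simp
  · intro v
    rw [h₂, Finset.sum_div]
    have := aux_finsum s
      (fun i _ => if t (σ i) = v then (1:ℝ) / Fintype.card ι else 0)
    calc _ = ∑ᶠ w, ∑ i, (if s i = w then
              (if t (σ i) = v then (1:ℝ) / Fintype.card ι else 0) else 0) := by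
            refine finsum_congr fun w => Finset.sum_congr rfl fun i _ => ?_
            simp only [Prod.mk.injEq]; split_ifs <;> simp_all
      _ = ∑ i, (fun j => if t j = v then (1:ℝ) / Fintype.card ι else 0) (σ i) := this
      _ = ∑ j, (if t j = v then (1:ℝ) / Fintype.card ι else 0) :=
            Equiv.sum_comp σ (fun j => if t j = v then (1:ℝ) / Fintype.card ι else 0)
      _ = _ := by refine Finset.sum_congr rfl fun i _ => ?_
                  split_ifs <;> simp
  · have := aux_finsum (fun i => (s i, t (σ i)))
      (fun _ p => (1:ℝ) / Fintype.card ι * (G.dist p.1 p.2 : ℝ))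
    simp only [Finset.sum_mul, ite_mul, zero_mul]
    rw [Finset.sum_div]
    refine Eq.trans ?_ (this.symm.trans ?_)
    · exact Finset.sum_congr rfl fun i _ => by ring
    · refine finsum_congr fun p => Finset.sum_congr rfl fun i _ => ?_
      congr

open Classical in
lemma aux_birkhoff {ι : Type*} [Fintype ι] [Nonempty ι] (G : SimpleGraph V)
    (s t : ι → V) (m₁ m₂ : V → ℝ)
    (h₁ : ∀ u, m₁ u = (∑ i, if s i = u then (1:ℝ) else 0) / Fintype.card ι)
    (h₂ : ∀ u, m₂ u = (∑ i, if t i = u then (1:ℝ) else 0) / Fintype.card ι)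
    (A : V → V → ℝ) (hA : IsCoupling m₁ m₂ A) (c : ℝ)
    (hc : ∑ᶠ p : V × V, A p.1 p.2 * (G.dist p.1 p.2 : ℝ) < c) :
    ∃ σ : Equiv.Perm ι, ∑ i, (G.dist (s i) (t (σ i)) : ℝ) < Fintype.card ι * c := by
  have hN : (0:ℝ) < Fintype.card ι := by exact_mod_cast Fintype.card_pos
  obtain ⟨hfin, hnn, hr, hcol⟩ := hA
  have hfr : ∀ u, (Function.support fun v => A u v).Finite := fun u =>
    (hfin.preimage (f := fun v => (u, v)) (fun a _ b _ h => (Prod.mk.inj h).2)).subset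
      fun v hv => hv
  have hfc : ∀ v, (Function.support fun u => A u v).Finite := fun v =>
    (hfin.preimage (f := fun u => (u, v)) (fun a _ b _ h => (Prod.mk.inj h).1)).subset
      fun v hv => hv
  have hz₁ : ∀ u v, u ∉ Set.range s → A u v = 0 := by
    intro u v hu
    have h0 : m₁ u = 0 := by
      rw [h₁, Finset.sum_eq_zero fun i _ => if_neg fun e => hu ⟨i, e⟩, zero_div]
    have := single_le_finsum v (hfr u) (fun w => (hnn u w).1)
    rw [hr, h0] at this
    exact le_antisymm this (hnn u v).1
  have hz₂ : ∀ u v, v ∉ Set.range t → A u v = 0 := by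
    intro u v hu
    have h0 : m₂ v = 0 := by
      rw [h₂, Finset.sum_eq_zero fun i _ => if_neg fun e => hu ⟨i, e⟩, zero_div]
    have := single_le_finsum u (hfc v) (fun w => (hnn w v).1)
    rw [hcol, h0] at this
    exact le_antisymm this (hnn u v).1
  set n₁ : V → ℝ := fun u => ∑ i, if s i = u then (1:ℝ) else 0 with hn₁
  set n₂ : V → ℝ := fun u => ∑ i, if t i = u then (1:ℝ) else 0 with hn₂
  have p₁ : ∀ i, 0 < n₁ (s i) := fun i =>
    Finset.sum_pos' (fun _ _ => by split_ifs <;> norm_num) ⟨i, Finset.mem_univ _, by simp⟩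
  have p₂ : ∀ i, 0 < n₂ (t i) := fun i =>
    Finset.sum_pos' (fun _ _ => by split_ifs <;> norm_num) ⟨i, Finset.mem_univ _, by simp⟩
  let M : Matrix ι ι ℝ := fun i j =>
    Fintype.card ι / (n₁ (s i)) * (A (s i) (t j) / n₂ (t j))
  have hM : M ∈ doublyStochastic ℝ ι := by
    rw [mem_doublyStochastic_iff_sum]
    refine ⟨fun i j => ?_, fun i => ?_, fun j => ?_⟩
    · have := p₁ i; have := p₂ j; have := (hnn (s i) (t j)).1
      simp only [M]; positivity
    · simp only [M]
      rw [← Finset.mul_sum, aux_push t (fun v => A (s i) v) (fun v hv => hz₂ _ v hv), hr, h₁]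
      have := p₁ i
      simp only [hn₁] at this ⊢
      field_simp
    · have e : ∀ i, M i j = Fintype.card ι / (n₂ (t j)) * (A (s i) (t j) / n₁ (s i)) := by
        intro i; simp only [M]; ring
      simp only [e]
      rw [← Finset.mul_sum, aux_push s (fun v => A v (t j)) (fun v hv => hz₁ v _ hv), hcol, h₂]
      have := p₂ j
      simp only [hn₂] at this ⊢
      field_simp
  have hcost : ∑ i, ∑ j, M i j * (G.dist (s i) (t j) : ℝ)
      = Fintype.card ι * ∑ᶠ p : V × V, A p.1 p.2 * (G.dist p.1 p.2 : ℝ) := by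
    rw [← aux_push (fun q : ι × ι => (s q.1, t q.2))
      (fun p : V × V => A p.1 p.2 * (G.dist p.1 p.2 : ℝ)), Finset.mul_sum,
      ← Finset.univ_product_univ, Finset.sum_product]
    · refine Finset.sum_congr rfl fun i _ => Finset.sum_congr rfl fun j _ => ?_
      have : (∑ k ∈ (Finset.univ ×ˢ Finset.univ : Finset (ι × ι)), if (s k.1, t k.2) = (s i, t j) then (1:ℝ) else 0)
          = n₁ (s i) * n₂ (t j) := by
        rw [Finset.sum_product, hn₁, hn₂, Finset.sum_mul_sum]
        refine Finset.sum_congr rfl fun a _ => Finset.sum_congr rfl fun b _ => ?_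
        simp only [Prod.mk.injEq]
        split_ifs <;> simp_all
      have h4 : M i j * (G.dist (s i) (t j) : ℝ) = Fintype.card ι *
          (A (s i) (t j) * (G.dist (s i) (t j) : ℝ) / (n₁ (s i) * n₂ (t j))) := by
        simp only [M]
        have := p₁ i; have := p₂ j
        field_simp
      rw [h4, ← this]
      congr!
    · intro p hp
      by_cases h : p.1 ∈ Set.range s
      · have : p.2 ∉ Set.range t := by
          rintro ⟨j, hj⟩
          obtain ⟨i, hi⟩ := h
          exact hp ⟨(i, j), by ext <;> simp [hi, hj]⟩
        rw [hz₂ _ _ this, zero_mul]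
      · rw [hz₁ _ _ h, zero_mul]
  obtain ⟨w, hw0, hw1, hwM⟩ := exists_eq_sum_perm_of_mem_doublyStochastic hM
  by_contra! hcon
  have hexp : ∑ i, ∑ j, M i j * (G.dist (s i) (t j) : ℝ)
      = ∑ σ, w σ * ∑ i, (G.dist (s i) (t (σ i)) : ℝ) := by
    rw [← hwM]
    simp only [Matrix.sum_apply, Matrix.smul_apply, Equiv.Perm.permMatrix, smul_eq_mul,
      PEquiv.toMatrix_apply, Equiv.toPEquiv_apply, Option.mem_def, Option.some.injEq,
      Finset.sum_mul, mul_ite, mul_one, mul_zero, ite_mul, zero_mul, Finset.mul_sum]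
    rw [Finset.sum_congr rfl fun i _ => Finset.sum_comm, Finset.sum_comm]
    simp
  have : ∑ σ, w σ * (Fintype.card ι * c) ≤ ∑ σ, w σ * ∑ i, (G.dist (s i) (t (σ i)) : ℝ) :=
    Finset.sum_le_sum fun σ _ => mul_le_mul_of_nonneg_left (hcon σ) (hw0 σ)
  rw [← Finset.sum_mul, hw1, one_mul, ← hexp, hcost] at this
  have := le_of_mul_le_mul_left this hN
  linarith

open Classical in
lemma aux_transport {ι : Type*} [Fintype ι] [Nonempty ι] (G : SimpleGraph V)
    (s t : ι → V) (m₁ m₂ : V → ℝ)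
    (h₁ : ∀ u, m₁ u = (∑ i, if s i = u then (1:ℝ) else 0) / Fintype.card ι)
    (h₂ : ∀ u, m₂ u = (∑ i, if t i = u then (1:ℝ) else 0) / Fintype.card ι)
    (hW : transportDist G m₁ m₂ < 1) :
    transportDist G m₁ m₂ ≤ 1 - 1 / Fintype.card ι := by
  have hN : (0:ℝ) < Fintype.card ι := by exact_mod_cast Fintype.card_pos
  have hne : {w : ℝ | ∃ A : V → V → ℝ, IsCoupling m₁ m₂ A ∧
    w = ∑ᶠ p : V × V, A p.1 p.2 * (G.dist p.1 p.2 : ℝ)}.Nonempty :=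
    ⟨_, aux_perm G s t m₁ m₂ h₁ h₂ 1⟩
  obtain ⟨c, ⟨A, hA, rfl⟩, hc⟩ := exists_lt_of_csInf_lt hne hW
  obtain ⟨σ, hσ⟩ := aux_birkhoff G s t m₁ m₂ h₁ h₂ A hA 1 hc
  have h2 : (∑ i, (G.dist (s i) (t (σ i)) : ℝ)) + 1 ≤ Fintype.card ι := by
    rw [mul_one] at hσ
    exact_mod_cast hσ
  refine le_trans (b := (∑ i, (G.dist (s i) (t (σ i)) : ℝ)) / Fintype.card ι)
    (csInf_le ?_ (aux_perm G s t m₁ m₂ h₁ h₂ σ)) ?_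
  · refine ⟨0, ?_⟩
    rintro w ⟨B, hB, rfl⟩
    exact finsum_nonneg fun p => mul_nonneg (hB.2.1 _ _).1 (Nat.cast_nonneg _)
  · rw [div_le_iff₀ hN, sub_mul, div_mul_cancel₀ _ hN.ne']
    linarith

open Classical in
lemma aux_walk (G : SimpleGraph V) [G.LocallyFinite] (x : V) (n b N : ℕ)
    (hb : 0 < b) (hx : 0 < G.degree x) (hN : N = n + G.degree x * b) (u : V) :
    lazyWalk G ((n:ℝ) / N) x u
      = (∑ i : Fin n ⊕ (G.neighborFinset x × Fin b),
          if Sum.elim (fun _ => x) (fun p => (p.1 : V)) i = u then (1:ℝ) else 0) / N := by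
  have hNpos : (0:ℝ) < N := by
    have : 0 < N := by rw [hN]; positivity
    exact_mod_cast this
  have hs : (∑ i : Fin n ⊕ (G.neighborFinset x × Fin b),
          if Sum.elim (fun _ => x) (fun p => (p.1 : V)) i = u then (1:ℝ) else 0)
      = (if x = u then (n:ℝ) else 0) + (if G.Adj x u then (b:ℝ) else 0) := by
    rw [Fintype.sum_sum_type, Fintype.sum_prod_type]
    congr 1
    · by_cases h : x = u <;> simp [h]
    · calc _ = ∑ v : G.neighborFinset x, (b:ℝ) * (if (v:V) = u then (1:ℝ) else 0) := by
            refine Finset.sum_congr rfl fun v _ => ?_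
            by_cases h : (v:V) = u <;> simp [h]
        _ = ∑ v ∈ G.neighborFinset x, (b:ℝ) * (if v = u then (1:ℝ) else 0) :=
            Finset.sum_coe_sort (G.neighborFinset x) (fun v => (b:ℝ) * if v = u then (1:ℝ) else 0)
        _ = _ := by simp
  rw [hs]
  unfold lazyWalk
  by_cases h : u = x
  · subst h; simp
  · rw [if_neg h, if_neg (Ne.symm h)]
    split_ifs
    · have : (0:ℝ) < G.degree x := by exact_mod_cast hx
      have e : (N:ℝ) = n + G.degree x * b := by exact_mod_cast hN
      field_simp
      rw [e]; ring
    · simp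

lemma aux_alpha (G : SimpleGraph V) [G.LocallyFinite] (x y : V) (hxy : G.Adj x y) (n : ℕ)
    (hpos : 0 < alphaRicci G ((n:ℝ) / ((n + G.degree x * G.degree y : ℕ) : ℝ)) x y) :
    1 / ((n + G.degree x * G.degree y : ℕ) : ℝ) ≤
      alphaRicci G ((n:ℝ) / ((n + G.degree x * G.degree y : ℕ) : ℝ)) x y := by
  classical
  have hx : 0 < G.degree x := (G.degree_pos_iff_exists_adj x).2 ⟨y, hxy⟩
  have hy : 0 < G.degree y := (G.degree_pos_iff_exists_adj y).2 ⟨x, hxy.symm⟩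
  set N := n + G.degree x * G.degree y with hN
  have hd : G.dist x y = 1 := SimpleGraph.dist_eq_one_iff_adj.2 hxy
  unfold alphaRicci at hpos ⊢
  rw [hd, Nat.cast_one, div_one] at hpos ⊢
  have c1 : Fintype.card (Fin n ⊕ (G.neighborFinset x × Fin (G.degree y))) = N := by
    simp [hN]
  have c2 : Fintype.card (Fin n ⊕ (G.neighborFinset y × Fin (G.degree x))) = N := by
    simp [hN, mul_comm]
  let e1 := Fintype.equivFinOfCardEq c1
  let e2 := Fintype.equivFinOfCardEq c2
  have hNpos : 0 < N := by rw [hN]; positivity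
  haveI : Nonempty (Fin N) := ⟨⟨0, hNpos⟩⟩
  have := aux_transport (ι := Fin N) G
    (fun i => Sum.elim (fun _ => x) (fun p => (p.1 : V)) (e1.symm i))
    (fun i => Sum.elim (fun _ => y) (fun p => (p.1 : V)) (e2.symm i))
    (lazyWalk G ((n:ℝ) / N) x) (lazyWalk G ((n:ℝ) / N) y) ?_ ?_ (by linarith)
  · rw [Fintype.card_fin] at this
    linarith
  · intro u
    rw [aux_walk G x n _ N hy hx hN u, Fintype.card_fin, ← Equiv.sum_comp e1.symm]
  · intro u
    rw [aux_walk G y n _ N hx hy (by rw [hN, mul_comm]) u, Fintype.card_fin,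
      ← Equiv.sum_comp e2.symm]

/-- In a simple connected positively curved graph, every edge `xy` has Lin–Lu–Yau
Ricci curvature at least `1/(deg x · deg y)`. -/
theorem curvature_lower_bound_degrees (G : SimpleGraph V) [G.LocallyFinite]
    (hconn : G.Connected) (hpos : PositivelyCurved G) :
    ∀ x y : V, G.Adj x y → ∀ κ : ℝ, HasLLYCurv G x y κ →
      1 / ((G.degree x : ℝ) * (G.degree y : ℝ)) ≤ κ := by
  intro x y hxy κ hκ
  have hx : 0 < G.degree x := (G.degree_pos_iff_exists_adj x).2 ⟨y, hxy⟩
  have hy : 0 < G.degree y := (G.degree_pos_iff_exists_adj y).2 ⟨x, hxy.symm⟩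
  obtain ⟨κ', hκ'pos, hκ'⟩ := hpos hxy
  obtain rfl : κ = κ' := tendsto_nhds_unique hκ hκ'
  set D := G.degree x * G.degree y with hD
  have hDpos : 0 < D := by rw [hD]; positivity
  have hDR : (0:ℝ) < D := by exact_mod_cast hDpos
  have hlim : Tendsto (fun n : ℕ => (n:ℝ) / ((n + D : ℕ) : ℝ)) atTop
      (nhdsWithin 1 (Set.Iio 1)) := by
    refine tendsto_nhdsWithin_iff.2 ⟨?_, Eventually.of_forall fun n => ?_⟩
    · have := tendsto_natCast_div_add_atTop (𝕜 := ℝ) (D : ℝ)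
      simpa using this
    · rw [Set.mem_Iio, div_lt_one (by positivity)]
      push_cast; linarith
  have h := hκ.comp hlim
  refine ge_of_tendsto h ?_
  filter_upwards [h.eventually (lt_mem_nhds hκ'pos)] with n hn
  have hNpos : (0:ℝ) < ((n + D : ℕ) : ℝ) := by positivity
  have e : 1 - (n:ℝ) / ((n + D : ℕ) : ℝ) = D / ((n + D : ℕ) : ℝ) := by
    field_simp; push_cast; ring
  simp only [Function.comp, e] at hn ⊢
  have hp : (0:ℝ) < D / ((n + D : ℕ) : ℝ) := by positivity
  have hk := aux_alpha G x y hxy n ((div_pos_iff_of_pos_right hp).1 hn)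
  rw [le_div_iff₀ hp]
  refine le_trans (le_of_eq ?_) hk
  have : ((G.degree x : ℝ) * (G.degree y : ℝ)) = D := by rw [hD]; push_cast; rfl
  rw [this]
  field_simp
  try rfl
end
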